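/- arXiv:1605.03375 — 10 statements merged into one kernel-verified Lean document; each statement's English description precedes it below -/
import Mathlib

section
/- Let s and t be integers with 3 ≤ s < t. Then for every α ∈ F_{2^t}, the polynomial x^(2^s+1) + x^(2^(s−1)+1) + α·x is not a permutation polynomial of F_{2^t}. -/
/-- The sum of `2 ^ i` over `i ∈ M`. -/
def binarySum (M : Multiset ℕ) : ℕ := (M.map (2 ^ ·)).sum

/-- Cyclic shift by `s` or `s - 1` on `{0, …, t - 1}`. -/
def cyclicShift (s t i : ℕ) (b : Bool) : ℕ :=
  if i + s - b.toNat < t then i + s - b.toNat else i + s - b.toNat - t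

/-- The conjugate indices of the monomial obtained by choosing, for each `i ∈ I`, one of the terms
of the `2 ^ i`-th power of the trinomial. -/
def choiceIndices (s t : ℕ) (I : Finset ℕ) (c : I → Option Bool) : Multiset ℕ :=
  I.val + ∑ i : I, (c i).elim 0 fun b => {cyclicShift s t i b}

section PowerSums

variable {F : Type*} [Field F] [Fintype F] {t : ℕ}

lemma sum_pow_binarySum_merge (hF : Fintype.card F = 2 ^ t) (j : ℕ) (hj : j < t)
    (M : Multiset ℕ) :
    ∑ x : F, x ^ binarySum (j ::ₘ j ::ₘ M) =
      ∑ x : F, x ^ binarySum ((if j + 1 < t then j + 1 else 0) ::ₘ M) := by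
  refine Finset.sum_congr rfl fun x _ => ?_
  simp only [binarySum, Multiset.map_cons, Multiset.sum_cons, pow_add, ← mul_assoc]
  congr 1
  rw [← pow_add, ← two_mul, ← pow_succ']
  split_ifs with h
  · rfl
  · obtain rfl : t = j + 1 := by omega
    rw [← hF, FiniteField.pow_card, pow_zero, pow_one]

lemma exists_eq_cons_cons_of_not_nodup {M : Multiset ℕ} (h : ¬ M.Nodup) :
    ∃ j M', M = j ::ₘ j ::ₘ M' := by
  rw [Multiset.nodup_iff_le] at h
  push Not at h
  obtain ⟨j, hj⟩ := h
  obtain ⟨M', rfl⟩ := Multiset.le_iff_exists_add.1 hj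
  exact ⟨j, M', by simp⟩

lemma eq_range_of_nodup {M : Multiset ℕ} (h : M.Nodup) (hlt : ∀ a ∈ M, a < t)
    (hc : M.card = t) : M = Multiset.range t := by
  refine Multiset.eq_of_le_of_card_le ((Multiset.le_iff_subset h).2 fun a ha => ?_) (by simp [hc])
  simpa using hlt a ha

lemma binarySum_range_add_one (t : ℕ) : binarySum (Multiset.range t) + 1 = 2 ^ t := by
  have : binarySum (Multiset.range t) = ∑ i ∈ Finset.range t, 2 ^ i := rfl
  rw [this]
  have := Nat.geomSum_eq (le_refl 2) t
  have := Nat.one_le_two_pow (n := t)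
  omega

lemma sum_pow_binarySum_eq_zero (hF : Fintype.card F = 2 ^ t) (n : ℕ) :
    ∀ M : Multiset ℕ, M.card = n → (∀ a ∈ M, a < t) → n ≤ t → M ≠ Multiset.range t →
      ∑ x : F, x ^ binarySum M = 0 := by
  induction n with
  | zero =>
    intro M hM _ _ _
    rw [Multiset.card_eq_zero.1 hM]
    simp [binarySum]
  | succ n ih =>
    intro M hM hlt hn hne
    by_cases hnd : M.Nodup
    · refine FiniteField.sum_pow_lt_card_sub_one F _ ?_
      have hle : M ≤ Multiset.range t :=
        (Multiset.le_iff_subset hnd).2 fun a ha => by simpa using hlt a ha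
      obtain ⟨N, hN⟩ := Multiset.le_iff_exists_add.1 hle
      have hN0 : N ≠ 0 := by
        rintro rfl
        exact hne (by simpa using hN.symm)
      obtain ⟨a, ha⟩ := Multiset.exists_mem_of_ne_zero hN0
      obtain ⟨N', rfl⟩ := Multiset.exists_cons_of_mem ha
      have h1 := binarySum_range_add_one t
      rw [hN] at h1
      simp only [binarySum, Multiset.map_add, Multiset.map_cons, Multiset.sum_add,
        Multiset.sum_cons] at h1 ⊢
      have := Nat.one_le_two_pow (n := a)
      omega
    · obtain ⟨j, M', rfl⟩ := exists_eq_cons_cons_of_not_nodup hnd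
      have hj : j < t := hlt j (by simp)
      rw [sum_pow_binarySum_merge hF j hj]
      simp only [Multiset.card_cons] at hM
      refine ih _ (by simpa using hM) ?_ (by omega) ?_
      · intro a ha
        rcases Multiset.mem_cons.1 ha with rfl | ha
        · split_ifs <;> omega
        · exact hlt a (by simp [ha])
      · intro h
        have := congrArg Multiset.card h
        simp only [Multiset.card_cons, Multiset.card_range] at this
        omega

lemma sum_pow_binarySum_range (hF : Fintype.card F = 2 ^ t) :
    ∑ x : F, x ^ binarySum (Multiset.range t) = -1 := by
  classical
  have h := binarySum_range_add_one t
  have hq : binarySum (Multiset.range t) = Fintype.card F - 1 := by omega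
  have h1 := Fintype.one_lt_card (α := F)
  rw [hq, ← Finset.sum_erase_add _ _ (Finset.mem_univ (0 : F)), zero_pow (by omega), add_zero,
    Finset.sum_congr rfl fun x hx =>
      FiniteField.pow_card_sub_one_eq_one x (Finset.ne_of_mem_erase hx)]
  simp only [Finset.sum_const, Finset.card_erase_of_mem (Finset.mem_univ (0 : F)),
    Finset.card_univ, nsmul_eq_mul, mul_one]
  rw [Nat.cast_sub h1.le]
  simp

lemma eq_range_or_count_of_sum_pow_ne_zero (hF : Fintype.card F = 2 ^ t) (ht : 2 ≤ t)
    {M : Multiset ℕ} (hlt : ∀ a ∈ M, a < t) (hcard : M.card ≤ t + 1)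
    (hM : ∑ x : F, x ^ binarySum M ≠ 0) :
    M = Multiset.range t ∨ M.card = t + 1 ∧ ∃ j, M.count j = 3 ∧
      (∀ a, a ≠ j → M.count a ≤ 1) ∧ M.count (if j + 1 < t then j + 1 else 0) = 0 := by
  rcases hcard.lt_or_eq with h | h
  · left
    by_contra hne
    exact hM (sum_pow_binarySum_eq_zero hF _ M rfl hlt (by omega) hne)
  · right
    refine ⟨h, ?_⟩
    have hnd : ¬ M.Nodup := fun hnd => by
      have := Multiset.card_le_card (t := Multiset.range t)
        ((Multiset.le_iff_subset hnd).2 fun a ha => by simpa using hlt a ha)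
      simp at this
      omega
    obtain ⟨j, M', rfl⟩ := exists_eq_cons_cons_of_not_nodup hnd
    have hj : j < t := hlt j (by simp)
    rw [sum_pow_binarySum_merge hF j hj] at hM
    simp only [Multiset.card_cons] at h
    have hr : (if j + 1 < t then j + 1 else 0) ::ₘ M' = Multiset.range t := by
      by_contra hne
      refine hM (sum_pow_binarySum_eq_zero hF _ _ rfl ?_ (by simp; omega) hne)
      intro a ha
      rcases Multiset.mem_cons.1 ha with rfl | ha
      · split_ifs <;> omega
      · exact hlt a (by simp [ha])
    have hc : ∀ a, Multiset.count a M' + (if a = (if j + 1 < t then j + 1 else 0) then 1 else 0)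
        = if a < t then 1 else 0 := by
      intro a
      rw [← Multiset.count_cons, hr]
      split_ifs with ha
      · exact Multiset.count_eq_one_of_mem (Multiset.nodup_range t) (by simpa using ha)
      · exact Multiset.count_eq_zero_of_notMem (by simpa using ha)
    have hsucc : (if j + 1 < t then j + 1 else 0) ≠ j := by split_ifs <;> omega
    have hslt : (if j + 1 < t then j + 1 else 0) < t := by split_ifs <;> omega
    refine ⟨j, ?_, fun a ha => ?_, ?_⟩
    · have := hc j
      simp only [Multiset.count_cons_self]
      rw [if_neg hsucc.symm, if_pos hj] at this
      omega
    · have := hc a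
      rw [Multiset.count_cons_of_ne ha, Multiset.count_cons_of_ne ha]
      split_ifs at this <;> omega
    · have := hc (if j + 1 < t then j + 1 else 0)
      rw [if_pos rfl, if_pos hslt] at this
      rw [Multiset.count_cons_of_ne hsucc, Multiset.count_cons_of_ne hsucc]
      omega

end PowerSums

section Choices

variable {s t : ℕ} {I : Finset ℕ}

lemma cyclicShift_lt (hst : s < t) {i : ℕ} (hi : i < t) (b : Bool) : cyclicShift s t i b < t := by
  unfold cyclicShift
  split_ifs <;> omega

lemma cyclicShift_false (i : ℕ) :
    cyclicShift s t i false = i + s ∧ i + s < t ∨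
      cyclicShift s t i false + t = i + s ∧ t ≤ i + s := by
  simp only [cyclicShift, Bool.toNat_false]
  split_ifs <;> omega

lemma cyclicShift_true (hs : 1 ≤ s) (i : ℕ) :
    cyclicShift s t i true + 1 = i + s ∧ i + s ≤ t ∨
      cyclicShift s t i true + 1 + t = i + s ∧ t < i + s := by
  simp only [cyclicShift, Bool.toNat_true]
  split_ifs <;> omega

lemma choiceIndices_lt (hst : s < t) (hI : ∀ i ∈ I, i < t) (c : I → Option Bool) :
    ∀ a ∈ choiceIndices s t I c, a < t := by
  intro a ha
  rcases Multiset.mem_add.1 ha with ha | ha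
  · exact hI a ha
  · obtain ⟨i, -, hi⟩ := Multiset.mem_sum.1 ha
    cases h : c i with
    | none => simp [h] at hi
    | some b =>
      simp only [h, Option.elim, Multiset.mem_singleton] at hi
      exact hi ▸ cyclicShift_lt hst (hI i i.2) b

lemma card_choiceIndices (c : I → Option Bool) :
    (choiceIndices s t I c).card = I.card + (Finset.univ.filter fun i => c i ≠ none).card := by
  simp only [choiceIndices, Multiset.card_add, Finset.card_val, Multiset.card_sum,
    Finset.card_filter]
  congr 1
  refine Finset.sum_congr rfl fun i _ => ?_
  cases h : c i <;> simp

lemma count_choiceIndices (c : I → Option Bool) (a : ℕ) :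
    (choiceIndices s t I c).count a = (if a ∈ I then 1 else 0) +
      (Finset.univ.filter fun i => (c i).map (cyclicShift s t i) = some a).card := by
  simp only [choiceIndices, Multiset.count_add, Multiset.count_sum', Finset.card_filter]
  congr 1
  · split_ifs with h
    · exact Multiset.count_eq_one_of_mem I.nodup h
    · exact Multiset.count_eq_zero_of_notMem h
  · refine Finset.sum_congr rfl fun i _ => ?_
    cases h : c i with
    | none => simp
    | some b => simp [Multiset.count_singleton, eq_comm]

lemma choiceIndices_eq_range (hst : s < t) (hI : ∀ i ∈ I, i < t) (c : I → Option Bool)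
    (hcard : I.card + (Finset.univ.filter fun i => c i ≠ none).card = t)
    (hnot : ∀ i b, c i = some b → cyclicShift s t i b ∉ I)
    (hinj : ∀ i i' b b', c i = some b → c i' = some b' →
      cyclicShift s t i b = cyclicShift s t i' b' → i = i') :
    choiceIndices s t I c = Multiset.range t := by
  refine eq_range_of_nodup ?_ (choiceIndices_lt hst hI c) (by rw [card_choiceIndices, hcard])
  rw [Multiset.nodup_iff_count_le_one]
  intro a
  rw [count_choiceIndices]
  have hle : (Finset.univ.filter fun i => (c i).map (cyclicShift s t i) = some a).card ≤ 1 := by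
    rw [Finset.card_le_one]
    intro i hi i' hi'
    simp only [Finset.mem_filter, Finset.mem_univ, true_and, Option.map_eq_some_iff] at hi hi'
    obtain ⟨b, hb, h⟩ := hi
    obtain ⟨b', hb', h'⟩ := hi'
    exact hinj i i' b b' hb hb' (h.trans h'.symm)
  split_ifs with h
  · have : (Finset.univ.filter fun i => (c i).map (cyclicShift s t i) = some a) = ∅ := by
      refine Finset.filter_eq_empty_iff.2 fun i _ hi => ?_
      obtain ⟨b, hb, hh⟩ := Option.map_eq_some_iff.1 hi
      exact hnot i b hb (hh ▸ h)
    rw [this, Finset.card_empty]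
  · omega

lemma two_le_count_of_mem {c : I → Option Bool} {i : I} {b : Bool} (hb : c i = some b)
    (h : cyclicShift s t i b ∈ I) :
    2 ≤ (choiceIndices s t I c).count (cyclicShift s t i b) := by
  rw [count_choiceIndices, if_pos h]
  have : 0 < (Finset.univ.filter
      fun k => (c k).map (cyclicShift s t k) = some (cyclicShift s t i b)).card :=
    Finset.card_pos.2 ⟨i, Finset.mem_filter.2 ⟨Finset.mem_univ _, by rw [hb]; rfl⟩⟩
  omega

lemma two_le_count_of_eq {c : I → Option Bool} {i i' : I} {b b' : Bool} (hb : c i = some b)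
    (hb' : c i' = some b') (hne : i ≠ i') (h : cyclicShift s t i b = cyclicShift s t i' b') :
    2 ≤ (choiceIndices s t I c).count (cyclicShift s t i b) := by
  rw [count_choiceIndices]
  have : 1 < (Finset.univ.filter
      fun k => (c k).map (cyclicShift s t k) = some (cyclicShift s t i b)).card :=
    Finset.one_lt_card.2 ⟨i, Finset.mem_filter.2 ⟨Finset.mem_univ _, by rw [hb]; rfl⟩,
      i', Finset.mem_filter.2 ⟨Finset.mem_univ _, by rw [hb', h]; rfl⟩, hne⟩
  omega

lemma exists_pair_of_count_eq_three {c : I → Option Bool} {j : ℕ}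
    (h : (choiceIndices s t I c).count j = 3) :
    ∃ i ∈ I, ∃ i' ∈ I, ∃ b b', i ≠ i' ∧ cyclicShift s t i b = j ∧ cyclicShift s t i' b' = j := by
  rw [count_choiceIndices] at h
  have : 1 < (Finset.univ.filter fun k => (c k).map (cyclicShift s t k) = some j).card := by
    split_ifs at h <;> omega
  obtain ⟨i, hi, i', hi', hne⟩ := Finset.one_lt_card.1 this
  simp only [Finset.mem_filter, Finset.mem_univ, true_and, Option.map_eq_some_iff] at hi hi'
  obtain ⟨b, -, h⟩ := hi
  obtain ⟨b', -, h'⟩ := hi'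
  exact ⟨i, i.2, i', i'.2, b, b', fun h => hne (Subtype.ext h), h, h'⟩

lemma eq_none_unique {c : I → Option Bool}
    (hcard : I.card + (Finset.univ.filter fun i => c i ≠ none).card + 1 = 2 * I.card)
    {i i' : I} (h : c i = none) (h' : c i' = none) : i = i' := by
  have h1 := Finset.card_filter_add_card_filter_not (s := (Finset.univ : Finset I))
    (fun i => c i ≠ none)
  rw [Finset.card_univ, Fintype.card_coe] at h1
  have h2 : (Finset.univ.filter fun i => ¬ c i ≠ none).card ≤ 1 := by omega
  exact Finset.card_le_one.1 h2 i (by simp [h]) i' (by simp [h'])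

lemma ne_none_of_card {c : I → Option Bool}
    (hcard : I.card ≤ (Finset.univ.filter fun i => c i ≠ none).card) (i : I) : c i ≠ none := by
  have : (Finset.univ.filter fun i => c i ≠ none) = Finset.univ :=
    Finset.eq_univ_of_card _ (le_antisymm (Finset.card_le_univ _) (by simpa using hcard))
  have hi := Finset.mem_univ i
  rw [← this] at hi
  simpa using hi

lemma card_ne_none_of_unique {c : I → Option Bool} {i₀ : I} (h : ∀ i, c i = none ↔ i = i₀) :
    (Finset.univ.filter fun i => c i ≠ none).card + 1 = I.card := by
  have : (Finset.univ.filter fun i => c i ≠ none) = Finset.univ.erase i₀ := by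
    ext i
    simp [h]
  rw [this, Finset.card_erase_add_one (Finset.mem_univ _)]
  simp

end Choices

section Trinomial

variable {F : Type*} [Field F] [Fintype F] {s t : ℕ}

lemma pow_two_pow_cyclicShift (hF : Fintype.card F = 2 ^ t) (x : F) (i : ℕ) (b : Bool) :
    x ^ 2 ^ (i + s - b.toNat) = x ^ 2 ^ cyclicShift s t i b := by
  unfold cyclicShift
  split_ifs with h
  · rfl
  · obtain ⟨k, hk⟩ := Nat.exists_eq_add_of_le (not_lt.1 h)
    rw [hk, Nat.add_sub_cancel_left, pow_add, pow_mul, ← hF, FiniteField.pow_card]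

variable [CharP F 2]

lemma trinomial_pow_two_pow (hF : Fintype.card F = 2 ^ t) (hs : 1 ≤ s) (α x : F) (i : ℕ) :
    (x ^ (2 ^ s + 1) + x ^ (2 ^ (s - 1) + 1) + α * x) ^ 2 ^ i =
      ∑ o : Option Bool, o.elim (α ^ 2 ^ i) (fun _ => 1) *
        x ^ (2 ^ i + o.elim 0 fun b => 2 ^ cyclicShift s t i b) := by
  have h (b : Bool) : x ^ 2 ^ cyclicShift s t i b = (x ^ 2 ^ (s - b.toNat)) ^ 2 ^ i := by
    rw [← pow_two_pow_cyclicShift hF, ← pow_mul, ← pow_add]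
    congr 2
    have := b.toNat_le
    omega
  rw [Fintype.sum_option, Fintype.sum_bool, add_pow_char_pow, add_pow_char_pow]
  simp only [Option.elim, pow_add, h, one_mul, mul_pow, Bool.toNat_true, Bool.toNat_false, pow_zero,
    pow_one, Nat.sub_zero]
  ring

lemma sum_trinomial_pow (hF : Fintype.card F = 2 ^ t) (hs : 1 ≤ s) (α : F) (I : Finset ℕ) :
    ∑ x : F, (x ^ (2 ^ s + 1) + x ^ (2 ^ (s - 1) + 1) + α * x) ^ (∑ i ∈ I, 2 ^ i) =
      ∑ c : I → Option Bool, (∏ i : I, (c i).elim (α ^ 2 ^ (i : ℕ)) (fun _ => 1)) *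
        ∑ x : F, x ^ binarySum (choiceIndices s t I c) := by
  simp only [Finset.mul_sum]
  rw [Finset.sum_comm]
  refine Finset.sum_congr rfl fun x _ => ?_
  rw [← Finset.prod_pow_eq_pow_sum, ← Finset.prod_coe_sort]
  simp only [trinomial_pow_two_pow hF hs]
  rw [Finset.prod_univ_sum, Fintype.piFinset_univ]
  refine Finset.sum_congr rfl fun c _ => ?_
  rw [Finset.prod_mul_distrib, Finset.prod_pow_eq_pow_sum]
  congr 2
  rw [Finset.sum_add_distrib, Finset.sum_coe_sort I (fun i => 2 ^ i)]
  simp only [binarySum, choiceIndices, Multiset.map_add, Multiset.sum_add]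
  congr 1
  rw [← Multiset.coe_mapAddMonoidHom, map_sum, ← Multiset.coe_sumAddMonoidHom, map_sum]
  refine Finset.sum_congr rfl fun i _ => ?_
  cases h : c i <;> simp

theorem not_bijective_of_unique_choice (hF : Fintype.card F = 2 ^ t) (hs : 1 ≤ s) (hst : s < t)
    {α : F} (hα : α ≠ 0) {I : Finset ℕ} (hI : ∀ i ∈ I, i < t) (hcard : 2 * I.card ≤ t + 1)
    (c₀ : I → Option Bool) (h₀ : choiceIndices s t I c₀ = Multiset.range t)
    (huniq : ∀ c, choiceIndices s t I c = Multiset.range t → c = c₀)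
    (hcarry : ∀ c j, (choiceIndices s t I c).card = t + 1 → (choiceIndices s t I c).count j = 3 →
      (∀ a, a ≠ j → (choiceIndices s t I c).count a ≤ 1) →
      (choiceIndices s t I c).count (if j + 1 < t then j + 1 else 0) ≠ 0) :
    ¬ Function.Bijective
        (fun x : F => x ^ (2 ^ s + 1) + x ^ (2 ^ (s - 1) + 1) + α * x) := by
  intro hbij
  have hsum := hbij.sum_comp fun y => y ^ (∑ i ∈ I, 2 ^ i)
  rw [sum_trinomial_pow hF hs, Finset.sum_eq_single c₀, h₀, sum_pow_binarySum_range hF] at hsum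
  · have hz : ∑ y : F, y ^ binarySum I.val = 0 := by
      have hIt : I.card < t := by omega
      refine sum_pow_binarySum_eq_zero hF _ _ rfl hI (by simpa using hIt.le) fun h => ?_
      have := congrArg Multiset.card h
      simp at this
      omega
    rw [show ∑ i ∈ I, 2 ^ i = binarySum I.val from rfl, hz] at hsum
    refine mul_ne_zero (Finset.prod_ne_zero_iff.2 fun i _ => ?_) (by simp) hsum
    cases c₀ i <;> simp [hα]
  · intro c _ hc
    rw [mul_eq_zero]
    right
    by_contra hne
    have hle : (choiceIndices s t I c).card ≤ t + 1 := by
      rw [card_choiceIndices]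
      have := Finset.card_le_univ (Finset.univ.filter fun i => c i ≠ none)
      rw [Fintype.card_coe] at this
      omega
    rcases eq_range_or_count_of_sum_pow_ne_zero hF (by omega) (choiceIndices_lt hst hI c) hle hne
      with h | ⟨h, j, h1, h2, h3⟩
    · exact hc (huniq c h)
    · exact hcarry c j h h1 h2 h3
  · simp

end Trinomial

section Evens

/-- The even numbers below `2 * m`. -/
def evens (m : ℕ) : Finset ℕ := (Finset.range m).image (2 * ·)

lemma mem_evens {m i : ℕ} : i ∈ evens m ↔ i % 2 = 0 ∧ i < 2 * m := by
  simp only [evens, Finset.mem_image, Finset.mem_range]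
  exact ⟨fun ⟨k, _, _⟩ => by omega, fun h => ⟨i / 2, by omega, by omega⟩⟩

lemma card_evens (m : ℕ) : (evens m).card = m := by
  rw [evens, Finset.card_image_of_injective _ fun a b h => by simpa using h, Finset.card_range]

end Evens

lemma choice_of_eq_range {s t : ℕ} {I : Finset ℕ} {c : I → Option Bool}
    (h : choiceIndices s t I c = Multiset.range t) :
    (∀ i b, c i = some b → cyclicShift s t i b ∉ I) ∧
      (∀ i i' b b', c i = some b → c i' = some b' →
        cyclicShift s t i b = cyclicShift s t i' b' → i = i') ∧
      I.card + (Finset.univ.filter fun i => c i ≠ none).card = t := by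
  have hnd : ∀ a, (choiceIndices s t I c).count a ≤ 1 := by
    rw [← Multiset.nodup_iff_count_le_one, h]
    exact Multiset.nodup_range t
  refine ⟨fun i b hb hmem => ?_, fun i i' b b' hb hb' heq => ?_, ?_⟩
  · have := two_le_count_of_mem hb hmem
    have := hnd (cyclicShift s t i b)
    omega
  · by_contra hne
    have := two_le_count_of_eq hb hb' hne heq
    have := hnd (cyclicShift s t i b)
    omega
  · rw [← card_choiceIndices (s := s) (t := t), h, Multiset.card_range]

section Cases

variable {F : Type*} [Field F] [Fintype F] [CharP F 2] {s t : ℕ} {α : F}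

lemma not_bijective_of_even (hF : Fintype.card F = 2 ^ t) (hs : 1 ≤ s) (hst : s < t)
    (hα : α ≠ 0) (ht : t % 2 = 0) :
    ¬ Function.Bijective
        (fun x : F => x ^ (2 ^ s + 1) + x ^ (2 ^ (s - 1) + 1) + α * x) := by
  have hcard := card_evens (t / 2)
  have hF' := cyclicShift_false (s := s) (t := t)
  have hT' := cyclicShift_true (s := s) (t := t) hs
  have hlt : ∀ i ∈ evens (t / 2), i < t := fun i hi => by rw [mem_evens] at hi; omega
  refine not_bijective_of_unique_choice hF hs hst hα hlt (by omega)
    (fun _ => some (decide (s % 2 = 0))) ?_ ?_ ?_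
  · refine choiceIndices_eq_range hst hlt _ ?_ ?_ ?_
    · simp [hcard]
      omega
    · intro i b hb hmem
      have hi := mem_evens.1 i.2
      rw [mem_evens] at hmem
      have := hF' i
      have := hT' i
      cases b <;> simp at hb <;> lia
    · intro i i' b b' hb hb' heq
      have hi := mem_evens.1 i.2
      have hi' := mem_evens.1 i'.2
      have := hF' i
      have := hT' i
      have := hF' i'
      have := hT' i'
      refine Subtype.ext ?_
      cases b <;> cases b' <;> simp at hb hb' <;> lia
  · intro c hc
    obtain ⟨h1, -, h3⟩ := choice_of_eq_range hc
    funext i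
    obtain ⟨b, hb⟩ := Option.ne_none_iff_exists'.1 (ne_none_of_card (c := c) (by omega) i)
    have hmem := h1 i b hb
    have hi := mem_evens.1 i.2
    rw [mem_evens] at hmem
    have := hF' i
    have := hT' i
    rw [hb]
    cases b <;> simp <;> lia
  · intro c j hc
    have := Finset.card_le_univ (Finset.univ.filter fun i => c i ≠ none)
    rw [Fintype.card_coe] at this
    rw [card_choiceIndices] at hc
    omega

lemma not_bijective_of_odd_of_odd (hF : Fintype.card F = 2 ^ t) (hs : 3 ≤ s) (hst : s < t)
    (hα : α ≠ 0) (ht : t % 2 = 1) (hs' : s % 2 = 1) :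
    ¬ Function.Bijective
        (fun x : F => x ^ (2 ^ s + 1) + x ^ (2 ^ (s - 1) + 1) + α * x) := by
  have hcard := card_evens ((t + 1) / 2)
  have hF' := cyclicShift_false (s := s) (t := t)
  have hT' := cyclicShift_true (s := s) (t := t) (by omega)
  have hlt : ∀ i ∈ evens ((t + 1) / 2), i < t := fun i hi => by rw [mem_evens] at hi; omega
  obtain ⟨k, hk⟩ : ∃ k : evens ((t + 1) / 2), (k : ℕ) + s = t :=
    ⟨⟨t - s, mem_evens.2 (by omega)⟩, by simp; omega⟩
  have hk_mem : ∀ b, cyclicShift s t k b ∈ evens ((t + 1) / 2) := by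
    intro b
    have := hF' k
    have := hT' k
    rw [mem_evens]
    cases b <;> omega
  refine not_bijective_of_unique_choice hF (by omega) hst hα hlt (by omega)
    (fun i => if i = k then none else some (decide (t ≤ i + s))) ?_ ?_ ?_
  · refine choiceIndices_eq_range hst hlt _ ?_ ?_ ?_
    · have := card_ne_none_of_unique (i₀ := k)
        (c := fun i => if i = k then none else some (decide (t ≤ i + s))) (by simp)
      omega
    · intro i b hb hmem
      have hi := mem_evens.1 i.2
      rw [mem_evens] at hmem
      have := hF' i
      have := hT' i
      have hik : (i : ℕ) ≠ k := fun h => by simp [Subtype.ext h] at hb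
      rw [Option.ite_none_left_eq_some] at hb
      cases b <;> simp at hb <;> lia
    · intro i i' b b' hb hb' heq
      have hi := mem_evens.1 i.2
      have hi' := mem_evens.1 i'.2
      have := hF' i
      have := hT' i
      have := hF' i'
      have := hT' i'
      have hik : (i : ℕ) ≠ k := fun h => by simp [Subtype.ext h] at hb
      have hik' : (i' : ℕ) ≠ k := fun h => by simp [Subtype.ext h] at hb'
      rw [Option.ite_none_left_eq_some] at hb hb'
      refine Subtype.ext ?_
      cases b <;> cases b' <;> simp at hb hb' <;> lia
  · intro c hc
    obtain ⟨h1, -, h3⟩ := choice_of_eq_range hc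
    have hnone : c k = none := by
      by_contra hne
      obtain ⟨b, hb⟩ := Option.ne_none_iff_exists'.1 hne
      exact h1 k b hb (hk_mem b)
    funext i
    split_ifs with hik
    · rw [hik, hnone]
    · obtain ⟨b, hb⟩ := Option.ne_none_iff_exists'.1 fun h =>
        hik (eq_none_unique (by omega) h hnone)
      have hmem := h1 i b hb
      have hi := mem_evens.1 i.2
      rw [mem_evens] at hmem
      rw [Subtype.ext_iff] at hik
      have := hF' i
      have := hT' i
      rw [hb]
      cases b <;> simp <;> lia
  · intro c j hc h1 h2 h3
    rw [card_choiceIndices] at hc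
    obtain ⟨b, hb⟩ := Option.ne_none_iff_exists'.1 (ne_none_of_card (c := c) (by omega) k)
    have hj : cyclicShift s t k b = j := by
      by_contra hj
      have := two_le_count_of_mem hb (hk_mem b)
      have := h2 _ hj
      omega
    obtain ⟨i, hi, i', hi', b₁, b₂, hii', hij, hij'⟩ := exists_pair_of_count_eq_three h1
    rw [mem_evens] at hi hi'
    have := hF' k
    have := hT' k
    have := hF' i
    have := hT' i
    have := hF' i'
    have := hT' i'
    clear hF' hT'
    cases b <;> cases b₁ <;> cases b₂ <;> omega

lemma not_bijective_of_odd_of_even (hF : Fintype.card F = 2 ^ t) (hs : 3 ≤ s) (hst : s < t)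
    (hα : α ≠ 0) (ht : t % 2 = 1) (hs' : s % 2 = 0) :
    ¬ Function.Bijective
        (fun x : F => x ^ (2 ^ s + 1) + x ^ (2 ^ (s - 1) + 1) + α * x) := by
  obtain ⟨I, hmemI, hcard⟩ : ∃ I : Finset ℕ,
      (∀ i, i ∈ I ↔ i % 2 = 0 ∧ 0 < i ∧ i < t ∨ i + s = t + 2) ∧ 2 * I.card = t + 1 := by
    refine ⟨insert (t + 2 - s) ((evens ((t + 1) / 2)).erase 0), fun i => ?_, ?_⟩
    · simp only [Finset.mem_insert, Finset.mem_erase, mem_evens]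
      omega
    · rw [Finset.card_insert_of_notMem (by simp only [Finset.mem_erase, mem_evens]; omega),
        Finset.card_erase_add_one (mem_evens.2 (by omega)), card_evens]
      omega
  have hF' := cyclicShift_false (s := s) (t := t)
  have hT' := cyclicShift_true (s := s) (t := t) (by omega)
  have hlt : ∀ i ∈ I, i < t := fun i hi => by rw [hmemI] at hi; omega
  obtain ⟨k, hk⟩ : ∃ k : I, (k : ℕ) + 2 * s = t + 3 ∨
      t + 3 ≤ 2 * s ∧ (k : ℕ) + 2 * s = 2 * t + 2 := by
    by_cases h : t + 3 ≤ 2 * s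
    · exact ⟨⟨2 * t + 2 - 2 * s, (hmemI _).2 (by omega)⟩, by simp; omega⟩
    · exact ⟨⟨t + 3 - 2 * s, (hmemI _).2 (by omega)⟩, by simp; omega⟩
  have hkI := (hmemI k).1 k.2
  have hk_mem : ∀ b, cyclicShift s t k b ∈ I := by
    intro b
    have := hF' k
    have := hT' k
    rw [hmemI]
    cases b <;> omega
  refine not_bijective_of_unique_choice hF (by omega) hst hα hlt (by omega)
    (fun i => if i = k then none else some (decide ((i : ℕ) + s ≤ t + 2))) ?_ ?_ ?_
  · refine choiceIndices_eq_range hst hlt _ ?_ ?_ ?_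
    · have := card_ne_none_of_unique (i₀ := k)
        (c := fun i => if i = k then none else some (decide ((i : ℕ) + s ≤ t + 2))) (by simp)
      omega
    · intro i b hb hmem
      have hi := (hmemI i).1 i.2
      rw [hmemI] at hmem
      have := hF' i
      have := hT' i
      have hik : (i : ℕ) ≠ k := fun h => by simp [Subtype.ext h] at hb
      rw [Option.ite_none_left_eq_some] at hb
      cases b <;> simp at hb <;> lia
    · intro i i' b b' hb hb' heq
      have hi := (hmemI i).1 i.2
      have hi' := (hmemI i').1 i'.2
      have := hF' i
      have := hT' i
      have := hF' i'
      have := hT' i'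
      have hik : (i : ℕ) ≠ k := fun h => by simp [Subtype.ext h] at hb
      have hik' : (i' : ℕ) ≠ k := fun h => by simp [Subtype.ext h] at hb'
      rw [Option.ite_none_left_eq_some] at hb hb'
      refine Subtype.ext ?_
      cases b <;> cases b' <;> simp at hb hb' <;> lia
  · intro c hc
    obtain ⟨h1, h2, h3⟩ := choice_of_eq_range hc
    have hnone : c k = none := by
      by_contra hne
      obtain ⟨b, hb⟩ := Option.ne_none_iff_exists'.1 hne
      exact h1 k b hb (hk_mem b)
    have hsome : ∀ i, i ≠ k → ∃ b, c i = some b := fun i hik =>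
      Option.ne_none_iff_exists'.1 fun h => hik (eq_none_unique (by omega) h hnone)
    obtain ⟨l, hl⟩ : ∃ l : I, (l : ℕ) + s = t + 2 :=
      ⟨⟨t + 2 - s, (hmemI _).2 (by omega)⟩, by simp; omega⟩
    have hcl : c l = some true := by
      obtain ⟨b, hb⟩ := hsome l (fun h => by rw [h] at hl; omega)
      have hmem := h1 l b hb
      rw [hmemI] at hmem
      have := hF' l
      cases b
      · omega
      · exact hb
    funext i
    split_ifs with hik
    · rw [hik, hnone]
    · obtain ⟨b, hb⟩ := hsome i hik
      have hmem := h1 i b hb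
      have hi := (hmemI i).1 i.2
      have hil := h2 i l b true hb hcl
      rw [hmemI] at hmem
      rw [Subtype.ext_iff] at hik hil
      have := hF' i
      have := hT' i
      have := hT' l
      rw [hb]
      cases b <;> simp <;> lia
  · intro c j hc h1 h2 h3
    rw [card_choiceIndices] at hc
    obtain ⟨b, hb⟩ := Option.ne_none_iff_exists'.1 (ne_none_of_card (c := c) (by omega) k)
    have hj : cyclicShift s t k b = j := by
      by_contra hj
      have := two_le_count_of_mem hb (hk_mem b)
      have := h2 _ hj
      omega
    have hsucc : (if j + 1 < t then j + 1 else 0) ∉ I := by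
      intro h
      rw [count_choiceIndices, if_pos h] at h3
      omega
    obtain ⟨i, hi, i', hi', b₁, b₂, hii', hij, hij'⟩ := exists_pair_of_count_eq_three h1
    rw [hmemI] at hi hi'
    have hj12 : j = 1 ∨ j = 2 := by
      have := hF' i
      have := hT' i
      have := hF' i'
      have := hT' i'
      clear hF' hT' h1 h2 h3 hkI hk
      cases b₁ <;> cases b₂ <;> omega
    have hjk : j + s = t + 1 ∨ j + s = t + 2 ∨ j + s = t + 3 := by
      have := hF' k
      have := hT' k
      cases b <;> omega
    rw [hmemI] at hsucc
    split_ifs at hsucc <;> omega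

end Cases

/-- For `3 ≤ s < t`, the trinomial `x^(2^s+1) + x^(2^(s-1)+1) + α·x` is not a
permutation polynomial of `F_{2^t}` for any `α`. -/
theorem trinomial_not_permutation_of_three_le
    (s t : ℕ) (hs : 3 ≤ s) (hst : s < t) (α : GaloisField 2 t) :
    ¬ Function.Bijective
        (fun x : GaloisField 2 t =>
          x ^ (2 ^ s + 1) + x ^ (2 ^ (s - 1) + 1) + α * x) := by
  have : Fintype (GaloisField 2 t) := Fintype.ofFinite _
  have hF : Fintype.card (GaloisField 2 t) = 2 ^ t := by
    rw [← Nat.card_eq_fintype_card, GaloisField.card 2 t (by omega)]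
  rcases eq_or_ne α 0 with rfl | hα
  · intro h
    refine zero_ne_one (h.injective (a₁ := 0) (a₂ := 1) ?_)
    simp [CharTwo.add_self_eq_zero]
  rcases Nat.mod_two_eq_zero_or_one t with ht | ht
  · exact not_bijective_of_even hF (by omega) hst hα ht
  rcases Nat.mod_two_eq_zero_or_one s with hs' | hs'
  · exact not_bijective_of_odd_of_even hF hs hst hα ht hs'
  · exact not_bijective_of_odd_of_odd hF hs hst hα ht hs'
end

section
/- Let t be a positive integer and α ∈ F_{2^t}. The map x ↦ x² + x^(2^(t−1)+1) + α·x is a bijection of F_{2^t} if and only if t = 1 and α = 1. (This is the case s = t of the trinomial x^(2^s+1) + x^(2^(s−1)+1) + α·x, reduced modulo x^(2^t) + x.) -/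
theorem Fintype.sum_inv {G M : Type*} [Group G] [Fintype G] [AddCommMonoid M] (f : G → M) :
    ∑ d : G, f d⁻¹ = ∑ d : G, f d :=
  Equiv.sum_comp (Equiv.inv G) f

/-- The absolute trace polynomial `x + x² + ⋯ + x^(2^(t-1))`. -/
def binaryTrace {K : Type*} [Field K] (t : ℕ) (x : K) : K :=
  ∑ i ∈ Finset.range t, x ^ 2 ^ i

namespace binaryTrace

open Finset

variable {K : Type*} [Field K] [CharP K 2] {t : ℕ}

theorem map_add (x y : K) :
    binaryTrace t (x + y) = binaryTrace t x + binaryTrace t y := by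
  simp only [binaryTrace, add_pow_char_pow, sum_add_distrib]

theorem sq_add (n : ℕ) (x : K) :
    binaryTrace n x ^ 2 + x = binaryTrace (n + 1) x := by
  have h : binaryTrace n x ^ 2 = ∑ i ∈ range n, x ^ 2 ^ (i + 1) := by
    have := map_sum (frobenius K 2) (fun i => x ^ 2 ^ i) (range n)
    simpa only [binaryTrace, frobenius_def, ← pow_mul, ← pow_succ] using this
  rw [h, binaryTrace, sum_range_succ']
  simp

variable [Fintype K]

theorem eq_zero_or_one (hK : Fintype.card K = 2 ^ t) (x : K) :
    binaryTrace t x = 0 ∨ binaryTrace t x = 1 := by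
  have h := sq_add t x
  have hx : x ^ 2 ^ t = x := by rw [← hK, FiniteField.pow_card]
  rw [binaryTrace, binaryTrace, sum_range_succ, hx] at h
  have h2 := add_right_cancel h
  rw [sq] at h2
  exact IsIdempotentElem.iff_eq_zero_or_one.mp h2

variable [DecidableEq K]

theorem sum_units_inv_mul (hK : Fintype.card K = 2 ^ t) (ht : 0 < t) :
    ∑ d : Kˣ, ((d⁻¹ : Kˣ) : K) * binaryTrace t (d : K) = 1 := by
  have hterm (i : ℕ) (d : Kˣ) :
      ((d⁻¹ : Kˣ) : K) * (d : K) ^ 2 ^ i = (d : K) ^ (2 ^ i - 1) := by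
    have : 2 ^ i = (2 ^ i - 1) + 1 := by have := Nat.one_le_two_pow (n := i); omega
    conv_lhs => rw [this, pow_succ']
    simp
  simp only [binaryTrace, mul_sum, hterm]
  rw [sum_comm, sum_eq_single_of_mem 0 (by simpa using ht)]
  · rw [FiniteField.sum_pow_units, if_pos (by simp), CharTwo.neg_eq]
  · intro i hi hi0
    rw [FiniteField.sum_pow_units, if_neg]
    intro hdvd
    have h1 : 2 ^ i < 2 ^ t := Nat.pow_lt_pow_right (by norm_num) (mem_range.mp hi)
    have h2 : 1 < 2 ^ i := Nat.one_lt_two_pow hi0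
    have := Nat.le_of_dvd (by omega) hdvd
    omega

theorem exists_eq_one (hK : Fintype.card K = 2 ^ t) (ht : 0 < t) :
    ∃ z : K, binaryTrace t z = 1 := by
  by_contra! h
  have h0 (z : K) : binaryTrace t z = 0 := (eq_zero_or_one hK z).resolve_right (h z)
  have := sum_units_inv_mul hK ht
  simp [h0] at this

theorem exists_sq_add_self (hK : Fintype.card K = 2 ^ t) (ht : 0 < t) {w : K}
    (hw : binaryTrace t w = 0) : ∃ u : K, u ^ 2 + u = w := by
  obtain ⟨z, hz⟩ := exists_eq_one hK ht
  set g : ℕ → K := fun i => binaryTrace i w * z ^ 2 ^ i with hg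
  have hsq (i : ℕ) : g i ^ 2 = g (i + 1) + w * z ^ 2 ^ (i + 1) := by
    have h2 : binaryTrace i w ^ 2 = binaryTrace (i + 1) w + w := by
      rw [← sq_add, add_assoc, CharTwo.add_self_eq_zero, add_zero]
    simp only [hg, mul_pow, h2, ← pow_mul, ← pow_succ, add_mul]
  have hz' : ∑ i ∈ range t, z ^ 2 ^ (i + 1) = 1 := by
    have h := sum_range_succ' (fun i => z ^ 2 ^ i) t
    have hzq : z ^ 2 ^ t = z := by rw [← hK, FiniteField.pow_card]
    rw [sum_range_succ, hzq] at h
    simp only [pow_zero, pow_one] at h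
    exact (add_right_cancel h).symm.trans hz
  have hg' : ∑ i ∈ range t, g (i + 1) = ∑ i ∈ range t, g i := by
    have h := sum_range_succ' g t
    rw [sum_range_succ] at h
    have h0 : g 0 = 0 := by simp [hg, binaryTrace]
    have h1 : g t = 0 := by simp [hg, hw]
    rw [h0, h1, add_zero, add_zero] at h
    exact h.symm
  refine ⟨∑ i ∈ range t, g i, ?_⟩
  have h := map_sum (frobenius K 2) g (range t)
  simp only [frobenius_def] at h
  rw [h]
  simp only [hsq]
  rw [sum_add_distrib, ← mul_sum, hz', hg', mul_one, add_right_comm,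
    CharTwo.add_self_eq_zero, zero_add]

theorem exists_add_mul_inv_eq_zero (hK : Fintype.card K = 2 ^ t) (ht : 1 < t) (a : K) :
    ∃ d : Kˣ, binaryTrace t (1 + (d : K) + a * ((d⁻¹ : Kˣ) : K)) = 0 := by
  by_contra! hne
  have h1 (d : Kˣ) : binaryTrace t (1 + (d : K) + a * ((d⁻¹ : Kˣ) : K)) = 1 :=
    (eq_zero_or_one hK _).resolve_left (hne d)
  have hq : 2 ^ 2 ≤ 2 ^ t := Nat.pow_le_pow_right (by norm_num) ht
  have hinv (c : K) : ∑ d : Kˣ, ((d⁻¹ : Kˣ) : K) * c = 0 := by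
    rw [← sum_mul, Fintype.sum_inv (fun d : Kˣ => (d : K))]
    have := FiniteField.sum_pow_units K 1
    rw [if_neg (by intro h; have := Nat.le_of_dvd one_pos h; omega)] at this
    simp only [pow_one] at this
    rw [this, zero_mul]
  have hB : ∑ d : Kˣ, ((d⁻¹ : Kˣ) : K) * binaryTrace t (a * ((d⁻¹ : Kˣ) : K)) = 1 := by
    have h : ∑ d : Kˣ, ((d⁻¹ : Kˣ) : K) *
        binaryTrace t (1 + (d : K) + a * ((d⁻¹ : Kˣ) : K)) = 0 := by
      simp only [h1]
      exact hinv 1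
    simp only [map_add, mul_add, sum_add_distrib] at h
    rw [hinv, zero_add, sum_units_inv_mul hK (by omega)] at h
    exact (CharTwo.add_eq_zero.mp h).symm
  have hB' : ∑ d : Kˣ, ((d⁻¹ : Kˣ) : K) * binaryTrace t (a * ((d⁻¹ : Kˣ) : K)) =
      ∑ i ∈ range t, a ^ 2 ^ i * ∑ d : Kˣ, (d : K) ^ (2 ^ i + 1) := by
    rw [Fintype.sum_inv (fun d : Kˣ => (d : K) * binaryTrace t (a * (d : K)))]
    simp only [binaryTrace, mul_sum]
    rw [sum_comm]
    refine sum_congr rfl fun i _ => sum_congr rfl fun d _ => ?_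
    ring
  rw [hB'] at hB
  obtain rfl | ht3 := (show 2 ≤ t from ht).eq_or_lt
  · have ha : a = 1 := by
      simp only [FiniteField.sum_pow_units, hK, sum_range_succ, range_zero, sum_empty] at hB
      norm_num at hB
      rw [CharTwo.neg_eq] at hB
      have : (a + 1) ^ 2 = 0 := by
        rw [CharTwo.add_sq, hB, one_pow, CharTwo.add_self_eq_zero]
      exact CharTwo.add_eq_zero.mp (pow_eq_zero_iff two_ne_zero |>.mp this)
    apply hne 1
    simp [ha, binaryTrace, CharTwo.add_self_eq_zero, CharTwo.two_eq_zero]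
  · rw [sum_eq_zero] at hB
    · exact zero_ne_one hB
    · intro i hi
      rw [FiniteField.sum_pow_units, if_neg, mul_zero]
      intro hdvd
      have hle := Nat.le_of_dvd (Nat.succ_pos _) hdvd
      rw [hK] at hle
      have h8 : 2 ^ 3 ≤ 2 ^ t := Nat.pow_le_pow_right (by norm_num) ht3
      have hi' : 2 ^ (i + 1) ≤ 2 ^ t :=
        Nat.pow_le_pow_right (by norm_num) (mem_range.mp hi)
      rw [pow_succ] at hi'
      omega

end binaryTrace

/-- Over a field of `2 ^ t > 2` elements, no quartic `y⁴ + y³ + a y²` is injective. -/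
theorem not_injective_quartic {K : Type*} [Field K] [CharP K 2] [Fintype K] {t : ℕ}
    (hK : Fintype.card K = 2 ^ t) (ht : 1 < t) (a : K) :
    ¬ Function.Injective (fun y : K => y ^ 4 + y ^ 3 + a * y ^ 2) := by
  intro hinj
  classical
  obtain ⟨d, hd⟩ := binaryTrace.exists_add_mul_inv_eq_zero hK ht a
  obtain ⟨u, hu⟩ := binaryTrace.exists_sq_add_self hK (by omega) hd
  have hd0 : (d : K) ≠ 0 := d.ne_zero
  have h2 : (2 : K) = 0 := CharTwo.two_eq_zero
  have hdi : (d : K) * ((d⁻¹ : Kˣ) : K) = 1 := d.mul_inv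
  have heq : (d : K) * u = d * u + d := by
    apply hinj
    generalize (d : K) = x at *
    generalize ((d⁻¹ : Kˣ) : K) = y at *
    linear_combination -x ^ 3 * hu - a * x ^ 2 * hdi +
      (-x ^ 4 * (2 * u ^ 3 + 3 * u ^ 2 + 2 * u + 1) - x ^ 3 * (u ^ 2 + u + 1) -
        a * x ^ 2 * (u + 1)) * h2
  exact hd0 (left_eq_add.mp heq)

/-- The case `s = t` of the trinomial: `x ↦ x² + x^(2^(t-1)+1) + α·x` is a
bijection of `F_{2^t}` iff `t = 1` and `α = 1`. -/
theorem trinomial_case_s_eq_t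
    (t : ℕ) (ht : 0 < t) (α : GaloisField 2 t) :
    Function.Bijective
        (fun x : GaloisField 2 t =>
          x ^ 2 + x ^ (2 ^ (t - 1) + 1) + α * x) ↔
      (t = 1 ∧ α = 1) := by
  have := Fintype.ofFinite (GaloisField 2 t)
  have hK : Fintype.card (GaloisField 2 t) = 2 ^ t := by
    rw [← Nat.card_eq_fintype_card, GaloisField.card 2 t ht.ne']
  constructor
  · rintro ⟨hinj, -⟩
    obtain rfl | ht1 := (show 1 ≤ t from ht).eq_or_lt
    · refine ⟨rfl, ?_⟩
      have hα : α ≠ 0 := by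
        rintro rfl
        refine zero_ne_one (hinj (a₁ := 0) (a₂ := 1) ?_)
        simp [CharTwo.add_self_eq_zero]
      have h := FiniteField.pow_card_sub_one_eq_one α hα
      simpa [hK] using h
    · refine absurd ?_ (not_injective_quartic hK ht1 α)
      have hfrob : Function.Injective (fun y : GaloisField 2 t => y ^ 2) :=
        frobenius_inj (GaloisField 2 t) 2
      convert hinj.comp hfrob using 2 with y
      have hy : (y ^ 2) ^ (2 ^ (t - 1) + 1) = y ^ 3 := by
        have hp : 2 * 2 ^ (t - 1) = 2 ^ t := by rw [← pow_succ']; congr 1; omega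
        rw [pow_succ, ← pow_mul, hp, ← hK, FiniteField.pow_card]
        ring
      simp only [Function.comp_apply, hy]
      ring
  · rintro ⟨rfl, rfl⟩
    convert Function.bijective_id using 2 with x
    simp [CharTwo.add_self_eq_zero]
end

section
/- Let s and t be integers with 3 ≤ s < t and let α ∈ F_{2^t}. Set f(x) = x^(2^s+1) + x^(2^(s−1)+1) + α·x ∈ F_{2^t}[x]. Then the coefficient of x^(2^t−1) in the remainder of f^(2^t−3) upon division by x^(2^t) − x equals α^(2^t − 2^(t−s+2) − 3) · (1 + Σ_{i=2}^{t−s+1} α^(2^i)). -/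
open Polynomial Finset

theorem FiniteField.sum_pow_mul_eval {K : Type*} [Field K] [Fintype K] {m : ℕ} (hm : 0 < m)
    (hmq : m < Fintype.card K) {P : K[X]} (hP : P.natDegree < Fintype.card K) :
    ∑ y : K, y ^ (Fintype.card K - 1 - m) * P.eval y = -P.coeff m := by
  classical
  set q := Fintype.card K with hq
  have key : ∀ n ∈ range q,
      ∑ y : K, y ^ (q - 1 - m) * (P.coeff n * y ^ n) = if n = m then -P.coeff m else 0 := by
    intro n hn
    rw [mem_range] at hn
    have hpull : ∑ y : K, y ^ (q - 1 - m) * (P.coeff n * y ^ n)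
        = P.coeff n * ∑ y : K, y ^ (q - 1 - m + n) := by
      rw [mul_sum]
      exact sum_congr rfl fun y _ => by ring
    rw [hpull]
    rcases lt_trichotomy n m with h | h | h
    · rw [if_neg h.ne, FiniteField.sum_pow_lt_card_sub_one K _ (by omega), mul_zero]
    · subst h
      have he : q - 1 - n + n = q - 1 := by omega
      have hsum : ∑ y : K, y ^ (q - 1) = -1 := by
        have h0 : ∀ y : K, y ^ (q - 1) = 1 - if y = 0 then 1 else 0 := by
          intro y
          split_ifs with hy
          · rw [hy, zero_pow (by omega), sub_self]
          · rw [FiniteField.pow_card_sub_one_eq_one y hy, sub_zero]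
        simp [h0]
      rw [if_pos rfl, he, hsum, mul_neg_one]
    · have he : ∀ y : K, y ^ (q - 1 - m + n) = y ^ (n - m) := by
        intro y
        have h1 : q - 1 - m + n = q + (n - m - 1) := by omega
        have h2 : n - m = 1 + (n - m - 1) := by omega
        rw [h1, pow_add, FiniteField.pow_card, h2, pow_add, pow_one, Nat.add_sub_cancel_left]
      simp_rw [he]
      rw [if_neg h.ne', FiniteField.sum_pow_lt_card_sub_one K _ (by omega), mul_zero]
  simp_rw [eval_eq_sum_range' hP, mul_sum]
  rw [sum_comm, sum_congr rfl key, sum_ite_eq' (range q), if_pos (mem_range.2 hmq)]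

theorem FiniteField.coeff_mod_X_pow_card_sub_X {K : Type*} [Field K] [Fintype K] (P : K[X]) :
    (P % (X ^ Fintype.card K - X)).coeff (Fintype.card K - 1) = -∑ y : K, P.eval y := by
  have hq : 1 < Fintype.card K := Fintype.one_lt_card
  have hdeg : (P % (X ^ Fintype.card K - X)).natDegree < Fintype.card K := by
    have h := FiniteField.X_pow_card_sub_X_natDegree_eq K hq
    conv_rhs => rw [← h]
    exact natDegree_mod_lt _ (by rw [h]; omega)
  have heval (y : K) : (P % (X ^ Fintype.card K - X)).eval y = P.eval y := by
    conv_rhs => rw [← EuclideanDomain.mod_add_div P (X ^ Fintype.card K - X)]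
    simp [FiniteField.pow_card]
  have h := FiniteField.sum_pow_mul_eval (K := K) (by omega) (by omega) hdeg (m := Fintype.card K - 1)
  simp only [Nat.sub_self, pow_zero, one_mul, heval] at h
  rw [h, neg_neg]

theorem pow_two_pow_succ_sub_one {M : Type*} [Monoid M] (a : M) (r : ℕ) :
    a ^ (2 ^ (r + 1) - 1) = a * (a ^ (2 ^ r - 1)) ^ 2 := by
  have : 2 ^ (r + 1) - 1 = 1 + (2 ^ r - 1) * 2 := by
    have := Nat.one_le_two_pow (n := r)
    rw [pow_succ]
    omega
  rw [this, pow_add, pow_one, pow_mul]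

section CharTwo

variable {K : Type*} [Field K] [CharP K 2]

theorem Polynomial.coeff_sq_two_mul (P : K[X]) (n : ℕ) :
    (P ^ 2).coeff (2 * n) = P.coeff n ^ 2 := by
  rw [← map_frobenius_expand (R := K) 2 P, coeff_map, mul_comm, coeff_expand_mul two_pos,
    frobenius_def]

theorem Polynomial.coeff_sq_two_mul_add_one (P : K[X]) (n : ℕ) :
    (P ^ 2).coeff (2 * n + 1) = 0 := by
  rw [← map_frobenius_expand (R := K) 2 P, coeff_map, coeff_expand two_pos,
    if_neg (by omega), map_zero]

theorem coeff_quadratic_mul_sq_two_mul_add_two (α : K) (P : K[X]) (n : ℕ) :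
    ((X ^ 2 + X + C α) * P ^ 2).coeff (2 * (n + 1)) = P.coeff n ^ 2 + α * P.coeff (n + 1) ^ 2 := by
  rw [add_mul, add_mul, coeff_add, coeff_add, coeff_C_mul, coeff_sq_two_mul, mul_add, mul_one,
    coeff_X_pow_mul, coeff_sq_two_mul, coeff_X_mul, coeff_sq_two_mul_add_one, add_zero]

theorem coeff_quadratic_mul_sq_two_mul_add_one (α : K) (P : K[X]) (n : ℕ) :
    ((X ^ 2 + X + C α) * P ^ 2).coeff (2 * n + 1) = P.coeff n ^ 2 := by
  have h : (X ^ 2 * P ^ 2).coeff (2 * n + 1) = 0 := by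
    rw [← mul_pow, coeff_sq_two_mul_add_one]
  rw [add_mul, add_mul, coeff_add, coeff_add, coeff_C_mul, h, coeff_X_mul, coeff_sq_two_mul,
    coeff_sq_two_mul_add_one, mul_zero, add_zero, zero_add]

theorem coeff_quadratic_pow_two_pow_sub_one_at_sub_one (α : K) (j d : ℕ) :
    ((X ^ 2 + X + C α) ^ (2 ^ (j + d) - 1)).coeff (2 ^ j - 1) = α ^ (2 ^ (j + d) - 2 ^ j) := by
  induction j with
  | zero => simp [coeff_zero_eq_eval_zero]
  | succ j ih =>
    have h1 := Nat.one_le_two_pow (n := j)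
    have h2 : 2 ^ (j + 1) - 1 = 2 * (2 ^ j - 1) + 1 := by rw [pow_succ]; omega
    have h3 : 2 ^ (j + d + 1) - 2 ^ (j + 1) = (2 ^ (j + d) - 2 ^ j) * 2 := by
      rw [pow_succ, pow_succ]; omega
    rw [add_right_comm j 1 d, pow_two_pow_succ_sub_one, h2, coeff_quadratic_mul_sq_two_mul_add_one, ih,
      h3, pow_mul]

theorem coeff_quadratic_pow_two_pow_sub_one_at_two_pow (α : K) (j d : ℕ) :
    ((X ^ 2 + X + C α) ^ (2 ^ (j + d + 1) - 1)).coeff (2 ^ j) =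
      α ^ (2 ^ (j + d + 1) - 2 ^ j - 1) * (1 + ∑ i ∈ range j, α ^ 2 ^ i) := by
  induction j with
  | zero =>
    have h1 := Nat.one_le_two_pow (n := d)
    have h2 : 2 ^ (0 + d + 1) - 2 ^ 0 - 1 = (2 ^ d - 1) * 2 := by
      rw [zero_add, pow_succ]; omega
    have h := coeff_quadratic_mul_sq_two_mul_add_one α ((X ^ 2 + X + C α) ^ (2 ^ d - 1)) 0
    rw [← pow_two_pow_succ_sub_one] at h
    rw [h2, zero_add, pow_zero]
    simpa [coeff_zero_eq_eval_zero, ← pow_mul] using h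
  | succ j ih =>
    have h1 := Nat.one_le_two_pow (n := j)
    have h2 : 2 ^ (j + 1) = 2 * (2 ^ j - 1 + 1) := by rw [pow_succ]; omega
    have hd : 2 * 2 ^ j ≤ 2 ^ (j + d + 1) := by
      rw [← pow_succ']; exact Nat.pow_le_pow_right two_pos (by omega)
    have h3 : 2 ^ (j + d + 1 + 1) - 2 ^ (j + 1) - 1 = (2 ^ (j + d + 1) - 2 ^ j - 1) * 2 + 1 := by
      rw [pow_succ 2 (j + d + 1), pow_succ 2 j]; omega
    have h4 : (2 ^ (j + d + 1) - 2 ^ j) * 2 = (2 ^ (j + d + 1) - 2 ^ j - 1) * 2 + 1 + 1 := by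
      omega
    have h5 : (∑ i ∈ range j, α ^ 2 ^ i) ^ 2 = ∑ i ∈ range j, α ^ 2 ^ (i + 1) := by
      rw [CharTwo.sum_sq]
      exact sum_congr rfl fun i _ => by rw [← pow_mul, ← pow_succ]
    have h6 := coeff_quadratic_pow_two_pow_sub_one_at_sub_one α j (d + 1)
    rw [← add_assoc] at h6
    rw [show j + 1 + d + 1 = j + d + 1 + 1 by ring, pow_two_pow_succ_sub_one]
    conv_lhs => rw [h2]
    rw [coeff_quadratic_mul_sq_two_mul_add_two, Nat.sub_add_cancel h1, ih, h6, h3, mul_pow,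
      ← pow_mul, ← pow_mul, CharTwo.add_sq, h5, h4, sum_range_succ']
    ring

end CharTwo

theorem sum_eval_pow_two_pow_sub_three {K : Type*} [Field K] [Fintype K] [CharP K 2]
    {s t : ℕ} (hK : Fintype.card K = 2 ^ t) (hs : 3 ≤ s) (hst : s < t) (α : K) :
    ∑ x : K, (x ^ (2 ^ s + 1) + x ^ (2 ^ (s - 1) + 1) + α * x) ^ (2 ^ t - 3) =
      (∑ y : K, y ^ (2 ^ t - 1 - 2 ^ (t - s)) *
        ((X ^ 2 + X + C α) ^ (2 ^ (t - 1) - 1)).eval y) ^ 4 := by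
  have hcard (y : K) : y ^ 2 ^ t = y := by rw [← hK]; exact FiniteField.pow_card y
  have h16 : 16 ≤ 2 ^ t := by
    simpa using Nat.pow_le_pow_right two_pos (show 4 ≤ t by omega)
  have hbij : Function.Bijective (fun y : K => y ^ 2 ^ (t - s + 1)) := by
    rw [← Finite.injective_iff_bijective]
    exact iterateFrobenius_inj K 2 (t - s + 1)
  have hlt : 4 * 2 ^ (t - s) ≤ 2 ^ (t - 1) := by
    rw [show 4 = 2 ^ 2 by rfl, ← pow_add]
    exact Nat.pow_le_pow_right two_pos (by omega)
  have ht : 2 ^ t = 2 * 2 ^ (t - 1) := by rw [← pow_succ']; congr 1; omega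
  rw [show (4 : ℕ) = 2 * 2 by rfl, pow_mul, CharTwo.sum_sq, CharTwo.sum_sq, ← hbij.sum_comp]
  refine sum_congr rfl fun y _ => ?_
  have hy : (y ^ 2 ^ (t - s + 1)) ^ 2 ^ (s - 1) = y := by
    rw [← pow_mul, ← pow_add, show t - s + 1 + (s - 1) = t by omega, hcard]
  have hy' : (y ^ 2 ^ (t - s + 1)) ^ 2 ^ s = y ^ 2 := by
    rw [show s = s - 1 + 1 by omega, pow_succ 2 (s - 1), pow_mul, show s - 1 + 1 = s by omega, hy]
  have hz (z : K) : z ^ (2 ^ t - 3) = ((z ^ (2 ^ (t - 1) - 1)) ^ 2) ^ 2 := by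
    rw [← pow_mul, ← pow_mul, show (2 ^ (t - 1) - 1) * (2 * 2) = 2 ^ t + (2 ^ t - 4) by omega,
      pow_add, hcard, ← pow_succ', show 2 ^ t - 4 + 1 = 2 ^ t - 3 by omega]
  have hx : (y ^ 2 ^ (t - s + 1)) ^ (2 ^ (t - 1) - 1) = y ^ (2 ^ t - 1 - 2 ^ (t - s)) := by
    rcases eq_or_ne y 0 with rfl | h0
    · rw [zero_pow (by positivity), zero_pow (by omega), zero_pow (by omega)]
    · have hne : y ^ 2 ^ (t - s + 1) ≠ 0 := pow_ne_zero _ h0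
      apply mul_right_cancel₀ hne
      rw [← pow_succ, Nat.sub_add_cancel Nat.one_le_two_pow, ← pow_mul, ← pow_add, ← pow_add,
        show t - s + 1 + (t - 1) = t + (t - s) by omega, pow_add, pow_mul, hcard, pow_succ,
        show 2 ^ t - 1 - 2 ^ (t - s) + 2 ^ (t - s) * 2 = (2 ^ t - 1) + 2 ^ (t - s) by omega,
        pow_add, ← hK, FiniteField.pow_card_sub_one_eq_one y h0, one_mul]
  simp only [eval_pow, eval_add, eval_X, eval_C]
  rw [hz, pow_succ (y ^ 2 ^ (t - s + 1)), pow_succ (y ^ 2 ^ (t - s + 1)), hy, hy', ← hx, ← add_mul,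
    ← add_mul, mul_comm, mul_pow]

/-- Coefficient of `x^(2^t-1)` in `f^(2^t-3) mod (x^(2^t) - x)`, where
`f = x^(2^s+1) + x^(2^(s-1)+1) + α·x  ∈ F_{2^t}[x]` and `3 ≤ s < t`. -/
theorem coeff_of_f_pow_two_pow_sub_three
    (s t : ℕ) (hs : 3 ≤ s) (hst : s < t) (α : GaloisField 2 t) :
    ((X ^ (2 ^ s + 1) + X ^ (2 ^ (s - 1) + 1) + C α * X : Polynomial (GaloisField 2 t))
          ^ (2 ^ t - 3) % (X ^ (2 ^ t) - X)).coeff (2 ^ t - 1) =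
      α ^ (2 ^ t - 2 ^ (t - s + 2) - 3) *
        (1 + ∑ i ∈ Finset.Icc 2 (t - s + 1), α ^ (2 ^ i)) := by
  have := Fintype.ofFinite (GaloisField 2 t)
  have hK : Fintype.card (GaloisField 2 t) = 2 ^ t := by
    rw [← Nat.card_eq_fintype_card, GaloisField.card 2 t (by omega)]
  have hcoeff := FiniteField.coeff_mod_X_pow_card_sub_X
    ((X ^ (2 ^ s + 1) + X ^ (2 ^ (s - 1) + 1) + C α * X : (GaloisField 2 t)[X]) ^ (2 ^ t - 3))
  have h16 : 16 ≤ 2 ^ t := by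
    simpa using Nat.pow_le_pow_right two_pos (show 4 ≤ t by omega)
  have ht : 2 ^ t = 2 * 2 ^ (t - 1) := by rw [← pow_succ']; congr 1; omega
  have hlt : 4 * 2 ^ (t - s) ≤ 2 ^ (t - 1) := by
    rw [show 4 = 2 ^ 2 by rfl, ← pow_add]
    exact Nat.pow_le_pow_right two_pos (by omega)
  have hdeg : ((X ^ 2 + X + C α) ^ (2 ^ (t - 1) - 1)).natDegree <
      Fintype.card (GaloisField 2 t) := by
    have h2 : (X ^ 2 + X + C α).natDegree ≤ 2 := by compute_degree
    refine (natDegree_pow_le_of_le _ h2).trans_lt ?_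
    omega
  have hsum := FiniteField.sum_pow_mul_eval (Nat.two_pow_pos (t - s)) (by omega) hdeg
  have hu := coeff_quadratic_pow_two_pow_sub_one_at_two_pow α (t - s) (s - 2)
  rw [show t - s + (s - 2) + 1 = t - 1 by omega] at hu
  rw [hK] at hcoeff hsum
  have hpow : α ^ ((2 ^ (t - 1) - 2 ^ (t - s) - 1) * 4) = α ^ (2 ^ t - 2 ^ (t - s + 2) - 3) := by
    have hα : α ^ 2 ^ t = α := by rw [← hK]; exact FiniteField.pow_card α
    rw [pow_add 2 (t - s), show (2 ^ (t - 1) - 2 ^ (t - s) - 1) * 4 =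
      2 ^ t + (2 ^ t - 2 ^ (t - s) * 2 ^ 2 - 4) by omega, pow_add, hα, ← pow_succ']
    congr 1
    omega
  have hfour : (∑ i ∈ range (t - s), α ^ 2 ^ i) ^ 4 =
      ∑ i ∈ Finset.Icc 2 (t - s + 1), α ^ (2 ^ i) := by
    rw [← Ico_add_one_right_eq_Icc, sum_Ico_eq_sum_range, show (4 : ℕ) = 2 * 2 by rfl, pow_mul,
      CharTwo.sum_sq, CharTwo.sum_sq, show t - s + 1 + 1 - 2 = t - s by omega]
    refine sum_congr rfl fun i _ => ?_
    rw [← pow_mul, ← pow_mul, add_comm 2 i, pow_add 2 i 2, sq]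
  have hone (z : GaloisField 2 t) : (1 + z) ^ 4 = 1 + z ^ 4 := by
    rw [show (4 : ℕ) = 2 * 2 by rfl, pow_mul, pow_mul, CharTwo.add_sq, CharTwo.add_sq, one_pow,
      one_pow]
  rw [hcoeff]
  simp only [eval_pow, eval_add, eval_mul, eval_X, eval_C]
  rw [sum_eval_pow_two_pow_sub_three hK hs hst, hsum, hu, CharTwo.neg_eq, CharTwo.neg_eq, mul_pow,
    ← pow_mul, hpow, hone, hfour]
end

section
/- Let s and t be integers with 3 ≤ s < t and let α ∈ F_{2^t}. Set f(x) = x^(2^s+1) + x^(2^(s−1)+1) + α·x ∈ F_{2^t}[x]. Then the coefficient of x^(2^t−1) in the remainder of f^(2^t−4) upon division by x^(2^t) − x equals α^(2^t − 2^(t−s+2) − 2^(t−s+1) − 4) · (1 + Σ_{i=2}^{t−s} α^(2^i)) + α^(2^t − 2^(t−s+2) − 4) · (Σ_{i=2}^{t−s} α^(2^i)). -/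
open Polynomial Finset

section PowerSums

variable {K : Type*} [Field K] [Fintype K]

lemma FiniteField.sum_pow_eq_ite (e : ℕ) :
    ∑ x : K, x ^ e = if e ≠ 0 ∧ Fintype.card K - 1 ∣ e then -1 else 0 := by
  classical
  rcases eq_or_ne e 0 with rfl | he
  · simp
  · have h : ∑ x : K, x ^ e = ∑ u : Kˣ, (u : K) ^ e := by
      rw [Fintype.sum_eq_add_sum_subtype_ne _ (0 : K), zero_pow he, zero_add]
      exact (Fintype.sum_equiv unitsEquivNeZero _ _ fun u => by simp).symm
    simp only [he, ne_eq, not_false_eq_true, true_and]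
    rw [h, FiniteField.sum_pow_units]

/-- Power sums over a finite field extract coefficients of polynomials of small degree. -/
lemma FiniteField.sum_pow_mul_eval_s6 (p : K[X]) (N : ℕ) (hN : N ≤ Fintype.card K - 1)
    (hp : p.natDegree < Fintype.card K - 1 + N) :
    ∑ z : K, z ^ (Fintype.card K - 1 - N) * p.eval z = -p.coeff N := by
  have hq : 1 < Fintype.card K := Fintype.one_lt_card
  simp_rw [eval_eq_sum_range, mul_sum]
  rw [sum_comm]
  have key : ∀ j ∈ range (p.natDegree + 1),
      ∑ z : K, z ^ (Fintype.card K - 1 - N) * (p.coeff j * z ^ j) =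
        if j = N then -p.coeff N else 0 := by
    intro j hj
    have hj' : j < Fintype.card K - 1 + N := by
      have := mem_range.1 hj; omega
    have : ∀ z : K, z ^ (Fintype.card K - 1 - N) * (p.coeff j * z ^ j) =
        p.coeff j * z ^ (Fintype.card K - 1 - N + j) := fun z => by rw [pow_add]; ring
    simp_rw [this]
    rw [← mul_sum, FiniteField.sum_pow_eq_ite]
    by_cases hjN : j = N
    · subst hjN
      rw [if_pos, if_pos rfl, mul_neg_one]
      rw [Nat.sub_add_cancel hN]
      exact ⟨by omega, dvd_rfl⟩
    · rw [if_neg, if_neg hjN, mul_zero]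
      rintro ⟨h0, c, hc⟩
      rcases c with _ | _ | c
      · omega
      · omega
      · rw [mul_add, mul_add] at hc
        have := Nat.zero_le ((Fintype.card K - 1) * c)
        omega
  rw [sum_congr rfl key, sum_ite_eq']
  split_ifs with h
  · rfl
  · rw [coeff_eq_zero_of_natDegree_lt (by simpa using h), neg_zero]

lemma FiniteField.coeff_mod_X_pow_card_sub_X_s6 (g : K[X]) :
    (g % (X ^ Fintype.card K - X)).coeff (Fintype.card K - 1) = -∑ x : K, g.eval x := by
  have hq : 1 < Fintype.card K := Fintype.one_lt_card
  have hdeg : (X ^ Fintype.card K - X : K[X]).natDegree = Fintype.card K :=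
    FiniteField.X_pow_card_sub_X_natDegree_eq K hq
  have hlt : (g % (X ^ Fintype.card K - X)).natDegree < Fintype.card K := by
    have := natDegree_mod_lt g (q := (X ^ Fintype.card K - X : K[X])) (by omega)
    rwa [hdeg] at this
  have h := FiniteField.sum_pow_mul_eval_s6 (g % (X ^ Fintype.card K - X)) _ le_rfl (by omega)
  rw [eq_neg_iff_add_eq_zero, add_comm, ← eq_neg_iff_add_eq_zero, ← h]
  refine sum_congr rfl fun x _ => ?_
  have hg := congrArg (eval x) (EuclideanDomain.div_add_mod g (X ^ Fintype.card K - X))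
  simpa [FiniteField.pow_card] using hg.symm

end PowerSums

section TrinomialProduct

variable {K : Type*} [Field K]

/-- The product over `2 ≤ k < m + 2` of the trinomials `X ^ 2 ^ k + X ^ 2 ^ (k - 1) + α ^ 2 ^ k`. -/
noncomputable def trinomialProd (α : K) (m : ℕ) : K[X] :=
  ∏ i ∈ range m, (X ^ 2 ^ (i + 2) + X ^ 2 ^ (i + 1) + C (α ^ 2 ^ (i + 2)))

lemma trinomialProd_succ (α : K) (m : ℕ) :
    trinomialProd α (m + 1) =
      trinomialProd α m * (X ^ 2 ^ (m + 2) + X ^ 2 ^ (m + 1) + C (α ^ 2 ^ (m + 2))) :=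
  prod_range_succ _ _

lemma coeff_trinomialProd_succ (α : K) (m N : ℕ) :
    (trinomialProd α (m + 1)).coeff N =
      (if 2 ^ (m + 2) ≤ N then (trinomialProd α m).coeff (N - 2 ^ (m + 2)) else 0) +
      (if 2 ^ (m + 1) ≤ N then (trinomialProd α m).coeff (N - 2 ^ (m + 1)) else 0) +
      (trinomialProd α m).coeff N * α ^ 2 ^ (m + 2) := by
  rw [trinomialProd_succ, mul_add, mul_add, coeff_add, coeff_add, coeff_mul_X_pow',
    coeff_mul_X_pow', coeff_mul_C]

lemma natDegree_trinomialProd_add_four_le (α : K) (m : ℕ) :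
    (trinomialProd α m).natDegree + 4 ≤ 2 ^ (m + 2) := by
  induction m with
  | zero => simp [trinomialProd]
  | succ m ih =>
    rw [trinomialProd_succ]
    have h1 : (X ^ 2 ^ (m + 2) + X ^ 2 ^ (m + 1) + C (α ^ 2 ^ (m + 2)) : K[X]).natDegree
        ≤ 2 ^ (m + 2) := by
      have : 2 ^ (m + 1) ≤ 2 ^ (m + 2) := Nat.pow_le_pow_right two_pos (by omega)
      compute_degree
      simpa using this
    have h2 := natDegree_mul_le (p := trinomialProd α m)
      (q := X ^ 2 ^ (m + 2) + X ^ 2 ^ (m + 1) + C (α ^ 2 ^ (m + 2)))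
    have h3 : 2 ^ (m + 1 + 2) = 2 * 2 ^ (m + 2) := by ring
    omega

lemma coeff_trinomialProd_eq_zero (α : K) {m N : ℕ} (h : 2 ^ (m + 2) ≤ N) :
    (trinomialProd α m).coeff N = 0 :=
  coeff_eq_zero_of_natDegree_lt (by have := natDegree_trinomialProd_add_four_le α m; omega)

lemma coeff_zero_trinomialProd (α : K) (m : ℕ) :
    (trinomialProd α m).coeff 0 = α ^ (2 ^ (m + 2) - 4) := by
  induction m with
  | zero => simp [trinomialProd]
  | succ m ih =>
    have h : 2 ^ (m + 1 + 2) = 2 * 2 ^ (m + 2) := by ring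
    have h' := natDegree_trinomialProd_add_four_le α m
    rw [coeff_trinomialProd_succ, if_neg (by simp), if_neg (by simp), ih, zero_add, zero_add,
      ← pow_add]
    congr 1
    omega

lemma pow_four_mul_coeff_trinomialProd (α : K) (m : ℕ) :
    α ^ 4 * (trinomialProd α m).coeff (2 ^ (m + 1)) = ∑ i ∈ range m, α ^ 2 ^ (i + 2) := by
  induction m with
  | zero => simp [trinomialProd, coeff_one]
  | succ m ih =>
    have h : 2 ^ (m + 2) = 2 ^ (m + 1) + 2 ^ (m + 1) := by ring
    have h' := natDegree_trinomialProd_add_four_le α m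
    rw [coeff_trinomialProd_succ, if_pos le_rfl, if_pos (by omega), Nat.sub_self,
      coeff_trinomialProd_eq_zero α le_rfl, coeff_zero_trinomialProd, sum_range_succ, ← ih,
      show 2 ^ (m + 1 + 1) - 2 ^ (m + 1) = 2 ^ (m + 1) by omega, zero_mul, add_zero, mul_add,
      ← pow_add, Nat.add_sub_cancel' (by omega), add_comm]

lemma coeff_three_mul_trinomialProd (α : K) (m : ℕ) :
    (trinomialProd α (m + 2)).coeff (3 * 2 ^ (m + 1)) =
      α ^ (2 ^ (m + 2) - 4) +
        (α ^ 2 ^ (m + 2) + α ^ 2 ^ (m + 3)) * (trinomialProd α m).coeff (2 ^ (m + 1)) := by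
  have h1 : 2 ^ (m + 2) = 2 * 2 ^ (m + 1) := by ring
  have h2 : 2 ^ (m + 1 + 2) = 4 * 2 ^ (m + 1) := by ring
  have h3 := Nat.two_pow_pos (m + 1)
  rw [coeff_trinomialProd_succ, if_neg (by omega), if_pos (by omega),
    show 3 * 2 ^ (m + 1) - 2 ^ (m + 1 + 1) = 2 ^ (m + 1) by omega,
    coeff_trinomialProd_succ, if_neg (by omega), if_pos le_rfl, Nat.sub_self,
    coeff_trinomialProd_succ, if_pos (by omega), if_pos (by omega),
    show 3 * 2 ^ (m + 1) - 2 ^ (m + 2) = 2 ^ (m + 1) by omega,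
    coeff_trinomialProd_eq_zero α (m := m) (N := 3 * 2 ^ (m + 1) - 2 ^ (m + 1)) (by omega),
    coeff_trinomialProd_eq_zero α (m := m) (N := 3 * 2 ^ (m + 1)) (by omega), coeff_zero_trinomialProd]
  ring

lemma coeff_trinomialProd_add (α : K) {m N : ℕ} (hN : N < 2 ^ (m + 1)) (j : ℕ) :
    (trinomialProd α (m + j)).coeff N =
      (trinomialProd α m).coeff N * α ^ (2 ^ (m + j + 2) - 2 ^ (m + 2)) := by
  induction j with
  | zero => simp
  | succ j ih =>
    have h1 : 2 ^ (m + 1) ≤ 2 ^ (m + j + 1) := Nat.pow_le_pow_right two_pos (by omega)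
    have h2 : 2 ^ (m + j + 2) = 2 * 2 ^ (m + j + 1) := by ring
    have h3 : 2 ^ (m + 2) = 2 * 2 ^ (m + 1) := by ring
    have h4 : 2 ^ (m + j + 1 + 2) = 4 * 2 ^ (m + j + 1) := by ring
    rw [← add_assoc, coeff_trinomialProd_succ, if_neg (by omega), if_neg (by omega), ih, zero_add,
      zero_add, mul_assoc, ← pow_add]
    congr 2
    omega

end TrinomialProduct

lemma pow_two_pow_sub_four_eq_prod {M : Type*} [CommMonoid M] (y : M) (m : ℕ) :
    y ^ (2 ^ (m + 2) - 4) = ∏ i ∈ range m, y ^ 2 ^ (i + 2) := by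
  induction m with
  | zero => simp
  | succ m ih =>
    have h1 : 2 ^ (m + 1 + 2) = 2 * 2 ^ (m + 2) := by ring
    have h2 : 2 ^ (m + 2) = 4 * 2 ^ m := by ring
    have h3 := Nat.two_pow_pos m
    rw [prod_range_succ, ← ih, ← pow_add]
    congr 1
    omega

section CharTwo

variable {K : Type*} [Field K] [Fintype K] [CharP K 2]

lemma pow_two_pow_sub_four_eq_eval {m : ℕ} (hK : Fintype.card K = 2 ^ (m + 2)) (α z : K) :
    (z + z ^ 2 ^ (m + 1) + α) ^ (2 ^ (m + 2) - 4) = (trinomialProd α m).eval z := by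
  rw [pow_two_pow_sub_four_eq_prod, trinomialProd, eval_prod]
  refine prod_congr rfl fun i _ => ?_
  have h : (z ^ 2 ^ (m + 1)) ^ 2 ^ (i + 2) = z ^ 2 ^ (i + 1) := by
    rw [← pow_mul, show 2 ^ (m + 1) * 2 ^ (i + 2) = 2 ^ (m + 2) * 2 ^ (i + 1) by ring, pow_mul,
      ← hK, FiniteField.pow_card]
  rw [add_pow_char_pow, add_pow_char_pow, h]
  simp

lemma sum_eval_pow_two_pow_sub_four {m n : ℕ} (hK : Fintype.card K = 2 ^ (m + 2)) (hn : n < m)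
    (α : K) :
    ∑ x : K, (x ^ (2 ^ (m + 2 - n) + 1) + x ^ (2 ^ (m + 1 - n) + 1) + α * x) ^ (2 ^ (m + 2) - 4) =
      -(trinomialProd α m).coeff (3 * 2 ^ n) := by
  have h1 : 2 ^ (n + 1) ≤ 2 ^ m := Nat.pow_le_pow_right two_pos hn
  have h2 : 2 ^ (n + 1) = 2 * 2 ^ n := by ring
  have h3 : 2 ^ (m + 2) = 4 * 2 ^ m := by ring
  have h4 := Nat.two_pow_pos n
  have h5 := natDegree_trinomialProd_add_four_le α m
  rw [← FiniteField.sum_pow_mul_eval_s6 (trinomialProd α m) (3 * 2 ^ n) (by omega) (by omega)]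
  have hbij : Function.Bijective fun z : K => z ^ 2 ^ n :=
    (Finite.injective_iff_bijective).1 (iterateFrobenius_inj K 2 n)
  refine (Fintype.sum_bijective _ hbij _ _ fun z => ?_).symm
  have hz1 : (z ^ 2 ^ n) ^ 2 ^ (m + 2 - n) = z := by
    rw [← pow_mul, ← pow_add, Nat.add_sub_cancel' (by omega), ← hK, FiniteField.pow_card]
  have hz2 : (z ^ 2 ^ n) ^ 2 ^ (m + 1 - n) = z ^ 2 ^ (m + 1) := by
    rw [← pow_mul, ← pow_add, Nat.add_sub_cancel' (by omega)]
  rw [pow_succ _ (2 ^ (m + 2 - n)), pow_succ _ (2 ^ (m + 1 - n)), hz1, hz2, ← add_mul, ← add_mul,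
    mul_pow, pow_two_pow_sub_four_eq_eval hK, mul_comm]
  congr 1
  rcases eq_or_ne z 0 with rfl | hz
  · rw [zero_pow (by omega), zero_pow (by omega), zero_pow (by omega)]
  · apply mul_right_cancel₀ (pow_ne_zero (3 * 2 ^ n) hz)
    have hone := FiniteField.pow_card_sub_one_eq_one z hz
    rw [← pow_add, Nat.sub_add_cancel (by omega), hone, ← pow_mul, ← pow_add,
      show 2 ^ n * (2 ^ (m + 2) - 4) + 3 * 2 ^ n = (Fintype.card K - 1) * 2 ^ n by
        rw [mul_comm 3, ← mul_add, mul_comm, hK]; congr 1; omega,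
      pow_mul, hone, one_pow]

end CharTwo

/-- Coefficient of `x^(2^t-1)` in `f^(2^t-4) mod (x^(2^t) - x)`, where
`f = x^(2^s+1) + x^(2^(s-1)+1) + α·x ∈ F_{2^t}[x]` and `3 ≤ s < t`. -/
theorem coeff_of_f_pow_two_pow_sub_four
    (s t : ℕ) (hs : 3 ≤ s) (hst : s < t) (α : GaloisField 2 t) :
    ((X ^ (2 ^ s + 1) + X ^ (2 ^ (s - 1) + 1) + C α * X : Polynomial (GaloisField 2 t))
          ^ (2 ^ t - 4) % (X ^ (2 ^ t) - X)).coeff (2 ^ t - 1) =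
      α ^ (2 ^ t - 2 ^ (t - s + 2) - 2 ^ (t - s + 1) - 4) *
          (1 + ∑ i ∈ Finset.Icc 2 (t - s), α ^ (2 ^ i)) +
        α ^ (2 ^ t - 2 ^ (t - s + 2) - 4) *
          (∑ i ∈ Finset.Icc 2 (t - s), α ^ (2 ^ i)) := by
  obtain ⟨j, rfl⟩ := Nat.exists_eq_add_of_le' hs
  obtain ⟨m, rfl⟩ := Nat.exists_eq_add_of_lt hst
  have := Fintype.ofFinite (GaloisField 2 (j + 3 + m + 1))
  have hK : Fintype.card (GaloisField 2 (j + 3 + m + 1)) = 2 ^ (j + 3 + m + 1) := by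
    rw [← Nat.card_eq_fintype_card, GaloisField.card 2 _ (by omega)]
  have hmod := FiniteField.coeff_mod_X_pow_card_sub_X_s6
    ((X ^ (2 ^ (j + 3) + 1) + X ^ (2 ^ (j + 3 - 1) + 1) + C α * X :
      (GaloisField 2 (j + 3 + m + 1))[X]) ^ (2 ^ (j + 3 + m + 1) - 4))
  have hsum := sum_eval_pow_two_pow_sub_four (m := m + 2 + j) (n := m + 1)
    (by rw [hK]; congr 1; omega) (by omega) α
  rw [show m + 2 + j + 2 - (m + 1) = j + 3 by omega,
    show m + 2 + j + 1 - (m + 1) = j + 3 - 1 by omega,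
    show m + 2 + j + 2 = j + 3 + m + 1 by omega] at hsum
  have hpow : 3 * 2 ^ (m + 1) < 2 ^ (m + 2 + 1) := by
    have : 2 ^ (m + 2 + 1) = 4 * 2 ^ (m + 1) := by ring
    have := Nat.two_pow_pos (m + 1)
    omega
  have hIcc : ∑ i ∈ Finset.Icc 2 (m + 1), α ^ 2 ^ i = ∑ i ∈ range m, α ^ 2 ^ (i + 2) := by
    rw [← Finset.Ico_add_one_right_eq_Icc, sum_Ico_eq_sum_range]
    exact sum_congr (by congr 1) fun i _ => by rw [add_comm 2 i]
  rw [hK] at hmod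
  rw [hmod]
  simp only [eval_pow, eval_add, eval_mul, eval_X, eval_C]
  rw [hsum, neg_neg, coeff_trinomialProd_add α hpow, coeff_three_mul_trinomialProd,
    show j + 3 + m + 1 - (j + 3) = m + 1 by omega, hIcc, ← pow_four_mul_coeff_trinomialProd,
    show m + 2 + j + 2 = j + 3 + m + 1 by omega]
  generalize (trinomialProd α m).coeff (2 ^ (m + 1)) = b
  have h1 : 2 ^ (m + 4) ≤ 2 ^ (j + 3 + m + 1) := Nat.pow_le_pow_right two_pos (by omega)
  have h2 : 2 ^ (m + 2) = 4 * 2 ^ m := by ring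
  have h3 : 2 ^ (m + 3) = 8 * 2 ^ m := by ring
  have h4 : 2 ^ (m + 4) = 16 * 2 ^ m := by ring
  have h5 := Nat.two_pow_pos m
  rw [show m + 2 + 2 = m + 4 by rfl, show m + 1 + 2 = m + 3 by rfl, show m + 1 + 1 = m + 2 by rfl,
    h2, h3]
  rw [h4] at h1 ⊢
  obtain ⟨r, hr⟩ := Nat.exists_eq_add_of_le h1
  rw [hr, show 16 * 2 ^ m + r - 16 * 2 ^ m = r by omega,
    show 16 * 2 ^ m + r - 8 * 2 ^ m - 4 * 2 ^ m - 4 = 4 * 2 ^ m - 4 + r by omega,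
    show 16 * 2 ^ m + r - 8 * 2 ^ m - 4 = 4 * 2 ^ m - 4 + 4 * 2 ^ m + r by omega]
  have h6 : α ^ (4 * 2 ^ m) = α ^ (4 * 2 ^ m - 4) * α ^ 4 := by
    rw [← pow_add, Nat.sub_add_cancel (by omega)]
  have h7 : α ^ (8 * 2 ^ m) = α ^ (4 * 2 ^ m) * α ^ (4 * 2 ^ m) := by
    rw [← pow_add]; congr 1; ring
  rw [h7, pow_add, pow_add, pow_add, h6]
  ring
end

section
/- Let s and t be integers with 3 ≤ s < t and let α ∈ F_{2^t} be nonzero with Σ_{i=2}^{t−s+1} α^(2^i) = 1. Set f(x) = x^(2^s+1) + x^(2^(s−1)+1) + α·x ∈ F_{2^t}[x]. Then the coefficient of x^(2^t−1) in the remainder of f^(2^t−4) upon division by x^(2^t) − x equals α^(2^t − 2^(t−s+1) − 4); in particular this coefficient is nonzero. -/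
open Polynomial Finset

namespace FiniteField

variable {K : Type*} [Field K] [Fintype K]

theorem sum_pow_eq_ite_s7 {i : ℕ} (hi : i ≠ 0) :
    ∑ x : K, x ^ i = if Fintype.card K - 1 ∣ i then -1 else 0 := by
  classical
  rw [← sum_pow_units K i, ← Fintype.sum_subtype_add_sum_subtype (fun x : K => x ≠ 0)]
  have hzero : ∑ x : {x : K // ¬ x ≠ 0}, (x : K) ^ i = 0 :=
    Finset.sum_eq_zero fun x _ => by rw [not_not.mp x.2, zero_pow hi]
  rw [hzero, add_zero]
  exact (Fintype.sum_equiv unitsEquivNeZero _ _ fun _ => rfl).symm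

theorem coeff_card_sub_one_mod (g : K[X]) :
    (g % (X ^ Fintype.card K - X)).coeff (Fintype.card K - 1) = -∑ x : K, g.eval x := by
  set q := Fintype.card K with hq
  have hq1 : 1 < q := Fintype.one_lt_card
  set r := g % (X ^ q - X) with hr
  have hdeg : r.natDegree < q := by
    have h := natDegree_mod_lt g (q := X ^ q - X)
      (by rw [X_pow_card_sub_X_natDegree_eq K hq1]; omega)
    rwa [X_pow_card_sub_X_natDegree_eq K hq1] at h
  have heval (x : K) : g.eval x = r.eval x := by
    conv_lhs => rw [← EuclideanDomain.div_add_mod g (X ^ q - X)]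
    simp [hr, hq, FiniteField.pow_card]
  have hsum : ∑ x : K, r.eval x = -r.coeff (q - 1) := by
    simp_rw [eval_eq_sum_range' hdeg]
    rw [Finset.sum_comm]
    simp_rw [← Finset.mul_sum]
    rw [Finset.sum_eq_single_of_mem (q - 1) (by simp; omega)]
    · rw [sum_pow_eq_ite_s7 (by omega), if_pos dvd_rfl, mul_neg_one]
    · intro i hi hne
      rw [sum_pow_lt_card_sub_one _ i (by simp at hi; omega), mul_zero]
  simp_rw [heval, hsum, neg_neg]

end FiniteField

section Trinomial

variable {R : Type*} [CommRing R]

theorem natDegree_trinomial_pow_le (a : R) (n : ℕ) :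
    ((C a + X + X ^ 2 : R[X]) ^ n).natDegree ≤ 2 * n := by
  rw [mul_comm]
  exact natDegree_pow_le_of_le n (by compute_degree)

theorem coeff_trinomial_pow_eq_zero (a : R) {n k : ℕ} (h : 2 * n < k) :
    ((C a + X + X ^ 2 : R[X]) ^ n).coeff k = 0 :=
  coeff_eq_zero_of_natDegree_lt ((natDegree_trinomial_pow_le a n).trans_lt h)

theorem coeff_zero_trinomial_pow (a : R) (n : ℕ) :
    ((C a + X + X ^ 2 : R[X]) ^ n).coeff 0 = a ^ n := by
  simp [coeff_zero_eq_eval_zero]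

variable [CharP R 2]

theorem add_add_pow_four (x y z : R) : (x + y + z) ^ 4 = x ^ 4 + y ^ 4 + z ^ 4 := by
  rw [show 4 = 2 ^ 2 from rfl, add_pow_char_pow, add_pow_char_pow]

theorem trinomial_pow_two_pow_s7 (a : R) (m : ℕ) :
    (C a + X + X ^ 2 : R[X]) ^ 2 ^ m =
      C (a ^ 2 ^ m) + X ^ 2 ^ m + X ^ (2 * 2 ^ m) := by
  rw [add_pow_char_pow, add_pow_char_pow, ← C_pow, ← pow_mul]

theorem mul_coeff_trinomial_pow_two_pow_sub_one (a : R) (m : ℕ) :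
    a * ((C a + X + X ^ 2 : R[X]) ^ (2 ^ m - 1)).coeff (2 ^ m) =
      ∑ j ∈ range m, a ^ 2 ^ j := by
  induction m with
  | zero => simp [coeff_one]
  | succ m ih =>
    have hpos : 0 < 2 ^ m := by positivity
    have hexp : 2 ^ (m + 1) - 1 = (2 ^ m - 1) + 2 ^ m := by rw [pow_succ]; omega
    rw [sum_range_succ, ← ih, hexp, pow_add, trinomial_pow_two_pow_s7, mul_add, mul_add,
      coeff_add, coeff_add, coeff_mul_C, coeff_mul_X_pow', coeff_mul_X_pow', pow_succ 2 m,
      coeff_trinomial_pow_eq_zero a (by omega : 2 * (2 ^ m - 1) < 2 ^ m * 2),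
      if_pos (by omega), if_pos (by omega), show 2 ^ m * 2 - 2 ^ m = 2 ^ m by omega,
      show 2 ^ m * 2 - 2 * 2 ^ m = 0 by omega, coeff_zero_trinomial_pow, zero_mul, zero_add,
      mul_add, mul_pow_sub_one hpos.ne']

theorem exists_trinomial_pow_four_mul_sub_one (b : R) (L : ℕ) (hL : 0 < L) (Y : R[X]) :
    ∃ E : R[X], (C b + Y + Y ^ 2) ^ (4 * L - 1) =
      C (b ^ (4 * (L - 1))) * (C (b ^ 3) + C (b ^ 2) * Y + C (b + b ^ 2) * Y ^ 2 + Y ^ 3) +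
        Y ^ 4 * E := by
  have h2 : (2 : R[X]) = 0 := CharTwo.two_eq_zero
  have h4 : (C b + Y + Y ^ 2) ^ 4 = C (b ^ 4) + Y ^ 4 * (1 + Y ^ 4) := by
    rw [add_add_pow_four, C_pow]
    ring
  obtain ⟨E, hE⟩ : Y ^ 4 ∣ (C b + Y + Y ^ 2) ^ (4 * (L - 1)) - C (b ^ (4 * (L - 1))) := by
    rw [pow_mul, h4, pow_mul b, C_pow (n := L - 1)]
    exact Dvd.dvd.trans ⟨1 + Y ^ 4, by ring⟩ (sub_dvd_pow_sub_pow _ _ _)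
  have h3 : (C b + Y + Y ^ 2) ^ 3 = C (b ^ 3) + C (b ^ 2) * Y + C (b + b ^ 2) * Y ^ 2 + Y ^ 3 +
      Y ^ 4 * (C b + 1 + Y + Y ^ 2) := by
    simp only [C_add, C_pow]
    linear_combination (C b ^ 2 * Y + C b * Y ^ 2 + C b ^ 2 * Y ^ 2 + 3 * C b * Y ^ 3 +
      C b * Y ^ 4 + Y ^ 4 + Y ^ 5) * h2
  refine ⟨C (b ^ (4 * (L - 1))) * (C b + 1 + Y + Y ^ 2) + E * (C b + Y + Y ^ 2) ^ 3, ?_⟩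
  rw [show 4 * L - 1 = 4 * (L - 1) + 3 by omega, pow_add, sub_eq_iff_eq_add.mp hE, add_mul]
  nth_rw 2 [h3]
  ring

theorem mul_coeff_trinomial_pow_of_sum_eq_one (a : R) (m L : ℕ) (hL : 0 < L)
    (ha : ∑ j ∈ range (m + 1), a ^ 2 ^ j = 1) :
    a * ((C a + X + X ^ 2 : R[X]) ^ (2 ^ m * (4 * L) - 1)).coeff (3 * 2 ^ m) =
      a ^ (2 ^ m * (4 * L - 1)) := by
  have hpos : 0 < 2 ^ m := by positivity
  have hexp : 2 ^ m * (4 * L) - 1 = (2 ^ m - 1) + 2 ^ m * (4 * L - 1) := by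
    obtain ⟨k, hk⟩ : ∃ k, 4 * L = k + 1 := ⟨4 * L - 1, by omega⟩
    rw [hk, mul_add, Nat.add_sub_cancel]
    omega
  have hp := mul_coeff_trinomial_pow_two_pow_sub_one a m
  rw [sum_range_succ, ← hp] at ha
  obtain ⟨E, hE⟩ := exists_trinomial_pow_four_mul_sub_one (a ^ 2 ^ m) L hL (X ^ 2 ^ m)
  have hcoeff : ((C a + X + X ^ 2 : R[X]) ^ (2 ^ m * (4 * L) - 1)).coeff (3 * 2 ^ m) =
      (a ^ 2 ^ m) ^ (4 * (L - 1)) * (((C a + X + X ^ 2 : R[X]) ^ (2 ^ m - 1)).coeff (2 ^ m) *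
        (a ^ 2 ^ m + (a ^ 2 ^ m) ^ 2) + a ^ (2 ^ m - 1)) := by
    rw [hexp, pow_add, pow_mul _ (2 ^ m), trinomial_pow_two_pow_s7, mul_comm 2, pow_mul X, hE]
    set b := a ^ 2 ^ m
    set p : R[X] := (C a + X + X ^ 2) ^ (2 ^ m - 1) with hpdef
    have h0 : p.coeff 0 = a ^ (2 ^ m - 1) := coeff_zero_trinomial_pow a _
    have h2 : p.coeff (2 * 2 ^ m) = 0 := coeff_trinomial_pow_eq_zero a (by omega)
    have h3 : p.coeff (3 * 2 ^ m) = 0 := coeff_trinomial_pow_eq_zero a (by omega)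
    have hsplit : p * (C (b ^ (4 * (L - 1))) * (C (b ^ 3) + C (b ^ 2) * X ^ 2 ^ m +
        C (b + b ^ 2) * (X ^ 2 ^ m) ^ 2 + (X ^ 2 ^ m) ^ 3) + (X ^ 2 ^ m) ^ 4 * E) =
        C (b ^ (4 * (L - 1))) * (C (b ^ 3) * p + C (b ^ 2) * (p * X ^ 2 ^ m) +
        C (b + b ^ 2) * (p * X ^ (2 * 2 ^ m)) + p * X ^ (3 * 2 ^ m)) +
        p * E * X ^ (4 * 2 ^ m) := by
      ring
    rw [hsplit]
    simp only [coeff_add, coeff_C_mul, coeff_mul_X_pow']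
    rw [if_pos (by omega), if_pos (by omega), if_pos le_rfl, if_neg (by omega),
      show 3 * 2 ^ m - 2 ^ m = 2 * 2 ^ m by omega,
      show 3 * 2 ^ m - 2 * 2 ^ m = 2 ^ m by omega, Nat.sub_self, h0, h2, h3]
    ring
  have hb : a * a ^ (2 ^ m - 1) = a ^ 2 ^ m := mul_pow_sub_one hpos.ne' a
  have h2 : (2 : R) = 0 := CharTwo.two_eq_zero
  rw [hcoeff, pow_mul a, show 4 * L - 1 = 4 * (L - 1) + 3 by omega, pow_add]
  generalize a ^ 2 ^ m = b at *
  generalize ((C a + X + X ^ 2 : R[X]) ^ (2 ^ m - 1)).coeff (2 ^ m) = p at *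
  linear_combination b ^ (4 * (L - 1)) * ((b + b ^ 2) * ha + hb + (b - b ^ 3) * h2)

end Trinomial

theorem two_pow_sub_one_dvd_iff {s m n : ℕ} (hs : 3 ≤ s) (hn : n ≤ 2 * (2 ^ (s + m - 1) - 1)) :
    2 ^ (s + 1 + m) - 1 ∣ 4 * (2 ^ (s + m - 1) - 1) + n * 2 ^ (s + 1) ↔ n = 3 * 2 ^ m := by
  obtain ⟨r, rfl⟩ : ∃ r, s = r + 3 := ⟨s - 3, by omega⟩
  rw [show r + 3 + m - 1 = r + 2 + m by omega] at *
  have hM : 0 < 2 ^ m := by positivity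
  have hrM : 2 ^ m ≤ 2 ^ (r + m) := Nat.pow_le_pow_right (by norm_num) (by omega)
  have hA : 2 ^ (r + 2 + m) = 4 * 2 ^ (r + m) := by ring
  have hQ : 2 ^ (r + 3 + 1 + m) = 16 * 2 ^ (r + m) := by ring
  have hS : (2 : ℤ) ^ (r + 3 + 1) * 2 ^ m = 16 * 2 ^ (r + m) := by ring
  rw [hA] at hn ⊢
  rw [hQ]
  zify [show 1 ≤ 16 * 2 ^ (r + m) by omega, show 1 ≤ 4 * 2 ^ (r + m) by omega] at hM hrM hn ⊢
  constructor
  · rintro ⟨c, hc⟩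
    have hdvd : (16 * 2 ^ (r + m) - 1 : ℤ) ∣ n - 3 * 2 ^ m :=
      ⟨c * 2 ^ m - n - 2 ^ m, by linear_combination 2 ^ m * hc - n * hS⟩
    have habs : |(n - 3 * 2 ^ m : ℤ)| < 16 * 2 ^ (r + m) - 1 := by
      rw [abs_lt]
      constructor <;> linarith
    linarith [Int.eq_zero_of_abs_lt_dvd hdvd habs]
  · intro hc
    exact ⟨4, by rw [hc]; linear_combination 3 * hS⟩

theorem FiniteField.coeff_pow_card_sub_four_mod_of_sum_eq_one {K : Type*} [Field K] [Fintype K]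
    [CharP K 2] {s t : ℕ} (hs : 3 ≤ s) (hst : s < t) (hcard : Fintype.card K = 2 ^ t)
    {α : K} (hα : α ≠ 0) (hsum : ∑ i ∈ Icc 2 (t - s + 1), α ^ 2 ^ i = 1) :
    ((X ^ (2 ^ s + 1) + X ^ (2 ^ (s - 1) + 1) + C α * X : K[X]) ^ (2 ^ t - 4) %
      (X ^ 2 ^ t - X)).coeff (2 ^ t - 1) = α ^ (2 ^ t - 2 ^ (t - s + 1) - 4) := by
  obtain ⟨m, rfl⟩ : ∃ m, t = s + 1 + m := ⟨t - s - 1, by omega⟩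
  obtain ⟨r, rfl⟩ : ∃ r, s = r + 3 := ⟨s - 3, by omega⟩
  have hk : r + 3 + 1 + m - (r + 3) + 1 = m + 2 := by omega
  rw [hk] at hsum ⊢
  have htrace : ∑ j ∈ range (m + 1), (α ^ 4) ^ 2 ^ j = 1 := by
    rw [← hsum, ← Finset.Ico_add_one_right_eq_Icc, Finset.sum_Ico_eq_sum_range]
    refine Finset.sum_congr (by congr 1) fun j _ => ?_
    rw [← pow_mul, pow_add, show 2 ^ 2 = 4 from rfl]
  have hpos : 0 < 2 ^ m := by positivity
  have hrM : 2 ^ m ≤ 2 ^ (r + m) := Nat.pow_le_pow_right (by norm_num) (by omega)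
  have hq : 2 ^ (r + 3 + 1 + m) = 16 * 2 ^ (r + m) := by ring
  have hN : 2 ^ (r + 3 + m - 1) = 4 * 2 ^ (r + m) := by
    rw [show r + 3 + m - 1 = r + m + 2 by omega]; ring
  set N := 2 ^ (r + 3 + m - 1) - 1 with hNdef
  have hqN : 2 ^ (r + 3 + 1 + m) - 4 = 4 * N := by omega
  set P : K[X] := C (α ^ 4) + X + X ^ 2 with hP
  have hvalue : (P ^ N).coeff (3 * 2 ^ m) =
      α ^ (2 ^ (r + 3 + 1 + m) - 2 ^ (m + 2) - 4) := by
    have h := mul_coeff_trinomial_pow_of_sum_eq_one (α ^ 4) m (2 ^ r) (by positivity) htrace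
    have hNL : 2 ^ m * (4 * 2 ^ r) - 1 = N := by rw [hNdef, hN]; congr 1; ring
    rw [hNL] at h
    apply mul_left_cancel₀ (pow_ne_zero 4 hα)
    rw [h, ← pow_mul, ← pow_add]
    congr 1
    have hM4 : 2 ^ (m + 2) = 4 * 2 ^ m := by ring
    have hexp : 4 * (2 ^ m * (4 * 2 ^ r - 1)) = 16 * 2 ^ (r + m) - 4 * 2 ^ m := by
      rw [Nat.mul_sub, Nat.mul_sub]; congr 1 <;> ring
    have hsmall : 4 * 2 ^ m + 4 ≤ 16 * 2 ^ (r + m) := by omega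
    omega
  have heval (x : K) : ((X ^ (2 ^ (r + 3) + 1) + X ^ (2 ^ (r + 3 - 1) + 1) + C α * X : K[X]) ^
      (4 * N)).eval x = ∑ n ∈ range (2 * N + 1),
        (P ^ N).coeff n * x ^ (4 * N + n * 2 ^ (r + 3 + 1)) := by
    have hfour : (x ^ (2 ^ (r + 3) + 1) + x ^ (2 ^ (r + 3 - 1) + 1) + α * x) ^ 4 =
        x ^ 4 * (α ^ 4 + x ^ 2 ^ (r + 3 + 1) + (x ^ 2 ^ (r + 3 + 1)) ^ 2) := by
      rw [add_add_pow_four, show r + 3 - 1 = r + 2 by omega]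
      ring
    have hPeval : (P ^ N).eval (x ^ 2 ^ (r + 3 + 1)) =
        (α ^ 4 + x ^ 2 ^ (r + 3 + 1) + (x ^ 2 ^ (r + 3 + 1)) ^ 2) ^ N := by
      simp [hP]
    have hlhs : ((X ^ (2 ^ (r + 3) + 1) + X ^ (2 ^ (r + 3 - 1) + 1) + C α * X : K[X]) ^
        (4 * N)).eval x = x ^ (4 * N) * (P ^ N).eval (x ^ 2 ^ (r + 3 + 1)) := by
      rw [hPeval, pow_mul x, ← mul_pow, ← hfour, ← pow_mul]
      simp
    rw [hlhs, eval_eq_sum_range' (Nat.lt_succ_of_le (natDegree_trinomial_pow_le (α ^ 4) N)),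
      Finset.mul_sum]
    refine Finset.sum_congr rfl fun n _ => ?_
    rw [pow_add, ← pow_mul, mul_comm n]
    ring
  rw [← hvalue, hqN, ← hcard, FiniteField.coeff_card_sub_one_mod]
  simp_rw [heval]
  rw [Finset.sum_comm]
  simp_rw [← Finset.mul_sum]
  rw [Finset.sum_eq_single_of_mem (3 * 2 ^ m) (by rw [Finset.mem_range]; omega)]
  · rw [FiniteField.sum_pow_eq_ite_s7 (by omega), hcard,
      if_pos ((two_pow_sub_one_dvd_iff hs (by omega)).mpr rfl), mul_neg_one, neg_neg]
  · intro n hn hne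
    rw [Finset.mem_range] at hn
    rw [FiniteField.sum_pow_eq_ite_s7 (by omega), hcard,
      if_neg fun h => hne ((two_pow_sub_one_dvd_iff hs (by omega)).mp h), mul_zero]

/-- If `3 ≤ s < t`, `α ≠ 0` and `∑_{i=2}^{t-s+1} α^(2^i) = 1`, then the
coefficient of `x^(2^t-1)` in `f^(2^t-4) mod (x^(2^t) - x)` equals
`α^(2^t - 2^(t-s+1) - 4)`; in particular it is nonzero. -/
theorem coeff_of_f_pow_two_pow_sub_four_of_sum_eq_one
    (s t : ℕ) (hs : 3 ≤ s) (hst : s < t) (α : GaloisField 2 t) (hα : α ≠ 0)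
    (hsum : ∑ i ∈ Finset.Icc 2 (t - s + 1), α ^ (2 ^ i) = 1) :
    ((X ^ (2 ^ s + 1) + X ^ (2 ^ (s - 1) + 1) + C α * X : Polynomial (GaloisField 2 t))
          ^ (2 ^ t - 4) % (X ^ (2 ^ t) - X)).coeff (2 ^ t - 1) =
        α ^ (2 ^ t - 2 ^ (t - s + 1) - 4) ∧
      ((X ^ (2 ^ s + 1) + X ^ (2 ^ (s - 1) + 1) + C α * X : Polynomial (GaloisField 2 t))
          ^ (2 ^ t - 4) % (X ^ (2 ^ t) - X)).coeff (2 ^ t - 1) ≠ 0 := by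
  let _ : Fintype (GaloisField 2 t) := Fintype.ofFinite _
  have hcard : Fintype.card (GaloisField 2 t) = 2 ^ t := by
    rw [← Nat.card_eq_fintype_card, GaloisField.card 2 t (by omega)]
  have hcoeff :=
    FiniteField.coeff_pow_card_sub_four_mod_of_sum_eq_one hs hst hcard hα hsum
  exact ⟨hcoeff, hcoeff ▸ pow_ne_zero _ hα⟩
end

section
/- Let s and t be positive integers, n = 2^s·t, and let a be a nonzero element of F_{2^n} lying in the subfield F_{2^{2t}} (i.e. a^(2^(2t)) = a). Then x^((2^n−1)/(2^t−1)+1) + a·x is a permutation polynomial of F_{2^n} if and only if a ∉ F_{2^t} (i.e. a^(2^t) ≠ a) and the map y ↦ y·(y + a)^((2^n−1)/(2^t−1)) is a bijection of the subfield F_{2^t} of F_{2^n}. (For y ∈ F_{2^t}, the value y·(y+a)^((2^n−1)/(2^t−1)) lies in F_{2^t}.) -/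
section NormExponent

variable {K : Type*} [Field K] [Finite K] {q d : ℕ}

/-- If `|K| - 1 = d * (q - 1)`, the `d`-th power of any element satisfies `x ^ q = x`. -/
lemma pow_pow_eq_self_of_card_sub_one (hq : 0 < q) (hd : 0 < d)
    (hK : Nat.card K - 1 = d * (q - 1)) (x : K) : (x ^ d) ^ q = x ^ d := by
  obtain ⟨r, rfl⟩ : ∃ r, q = r + 1 := ⟨q - 1, by omega⟩
  rcases eq_or_ne x 0 with rfl | hx
  · simp [hd.ne']
  · have := Fintype.ofFinite K
    have h1 := FiniteField.pow_card_sub_one_eq_one x hx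
    rw [← Nat.card_eq_fintype_card, hK, pow_mul, Nat.add_sub_cancel] at h1
    rw [pow_succ, h1, one_mul]

/-- If `|K| - 1 = d * (q - 1)`, every solution of `y ^ q = y` is a `d`-th power. -/
lemma exists_pow_eq_of_card_sub_one (hq : 1 < q) (hd : 0 < d)
    (hK : Nat.card K - 1 = d * (q - 1)) {y : K} (hy : y ^ q = y) : ∃ x : K, x ^ d = y := by
  rcases eq_or_ne y 0 with rfl | hy0
  · exact ⟨0, zero_pow hd.ne'⟩
  · obtain ⟨g, hg⟩ := IsCyclic.exists_monoid_generator (α := Kˣ)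
    obtain ⟨k, hk⟩ := Submonoid.mem_powers_iff _ _ |>.mp (hg (Units.mk0 y hy0))
    have hord : orderOf g = d * (q - 1) := by
      rw [orderOf_eq_card_of_forall_mem_powers hg, Nat.card_units, hK]
    have hyq : y ^ (q - 1) = 1 := by
      apply mul_right_cancel₀ hy0
      rw [← pow_succ, Nat.sub_add_cancel hq.le, hy, one_mul]
    have hgk : g ^ (k * (q - 1)) = 1 := by
      rw [pow_mul, hk]
      ext
      simpa using hyq
    have hdvd := orderOf_dvd_of_pow_eq_one hgk
    rw [hord] at hdvd
    obtain ⟨c, rfl⟩ := Nat.dvd_of_mul_dvd_mul_right (by omega) hdvd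
    refine ⟨((g ^ c : Kˣ) : K), ?_⟩
    rw [← Units.val_pow_eq_pow_val, ← pow_mul, mul_comm c d, hk, Units.val_mk0]

/-- The Wan–Lidl criterion for `x ^ (d + 1) + a * x` over a finite field of characteristic two. -/
lemma bijective_binomial_iff_of_card_sub_one [CharP K 2] (hq1 : 1 < q)
    (hd : 0 < d) (hK : Nat.card K - 1 = d * (q - 1)) {a : K} (ha : a ≠ 0) :
    Function.Bijective (fun x : K => x ^ (d + 1) + a * x) ↔
      (a ^ q ≠ a ∧ Set.BijOn (fun y : K => y * (y + a) ^ d)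
        {y : K | y ^ q = y} {y : K | y ^ q = y}) := by
  have hsub : ∀ x : K, (x ^ d) ^ q = x ^ d :=
    pow_pow_eq_self_of_card_sub_one (by omega) hd hK
  have hcomm : ∀ x : K, (x ^ (d + 1) + a * x) ^ d = x ^ d * (x ^ d + a) ^ d := fun x => by
    rw [← mul_pow]
    ring
  constructor
  · intro hf
    refine ⟨fun haq => ?_, ?_⟩
    · obtain ⟨x, hx⟩ := exists_pow_eq_of_card_sub_one hq1 hd hK haq
      have h0 : x = 0 := hf.1 (by
        simp only [pow_succ, hx, CharTwo.add_self_eq_zero]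
        simp)
      rw [h0, zero_pow hd.ne'] at hx
      exact ha hx.symm
    · have hmaps : Set.MapsTo (fun y : K => y * (y + a) ^ d)
          {y : K | y ^ q = y} {y : K | y ^ q = y} := by
        intro y hy
        simp only [Set.mem_ofPred_eq] at hy ⊢
        rw [mul_pow, hy, hsub]
      have hsurj : Set.SurjOn (fun y : K => y * (y + a) ^ d)
          {y : K | y ^ q = y} {y : K | y ^ q = y} := by
        intro y hy
        obtain ⟨z, rfl⟩ := exists_pow_eq_of_card_sub_one hq1 hd hK hy
        obtain ⟨x, rfl⟩ := hf.2 z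
        exact ⟨x ^ d, hsub x, (hcomm x).symm⟩
      exact (Set.toFinite _).surjOn_iff_bijOn_of_mapsTo hmaps |>.mp hsurj
  · rintro ⟨haq, hg⟩
    refine Finite.injective_iff_bijective.mp fun x z hxz => ?_
    have hN : x ^ d = z ^ d := hg.injOn (hsub x) (hsub z) (by
      simpa only [hcomm] using congrArg (· ^ d) hxz)
    have hne : x ^ d + a ≠ 0 := fun h => haq (CharTwo.add_eq_zero.mp h ▸ hsub x)
    apply mul_right_cancel₀ hne
    simp only [pow_succ, ← hN] at hxz
    linear_combination hxz

end NormExponent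

/-- Reduction via the Wan–Lidl criterion: for `n = 2^s·t` and nonzero
`a ∈ F_{2^{2t}} ⊆ F_{2^n}`, the binomial `x^((2^n-1)/(2^t-1)+1) + a·x` is a
permutation polynomial of `F_{2^n}` iff `a ∉ F_{2^t}` and
`y ↦ y·(y+a)^((2^n-1)/(2^t-1))` is a bijection of the subfield `F_{2^t}`. -/
theorem binomial_pp_iff_subfield_bijection
    (s t : ℕ) (hs : 0 < s) (ht : 0 < t) (n : ℕ) (hn : n = 2 ^ s * t)
    (a : GaloisField 2 n) (ha : a ≠ 0) (hasub : a ^ (2 ^ (2 * t)) = a) :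
    Function.Bijective
        (fun x : GaloisField 2 n => x ^ ((2 ^ n - 1) / (2 ^ t - 1) + 1) + a * x) ↔
      (a ^ (2 ^ t) ≠ a ∧
        Set.BijOn (fun y : GaloisField 2 n => y * (y + a) ^ ((2 ^ n - 1) / (2 ^ t - 1)))
          {y : GaloisField 2 n | y ^ (2 ^ t) = y}
          {y : GaloisField 2 n | y ^ (2 ^ t) = y}) := by
  have hdvd : 2 ^ t - 1 ∣ 2 ^ n - 1 :=
    Nat.pow_sub_one_dvd_pow_sub_one 2 ⟨2 ^ s, by rw [hn, mul_comm]⟩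
  have hn0 : n ≠ 0 := by
    rw [hn]
    positivity
  have ht1 : 1 < 2 ^ t := Nat.one_lt_two_pow ht.ne'
  have hn1 : 1 < 2 ^ n := Nat.one_lt_two_pow hn0
  refine bijective_binomial_iff_of_card_sub_one ht1
    (Nat.div_pos (Nat.le_of_dvd (by omega) hdvd) (by omega)) ?_ ha
  rw [GaloisField.card 2 n hn0, Nat.div_mul_cancel hdvd]
end

section
/- Let s and t be positive integers and n = 2^s·t. Let ζ ∈ F_{2^n} satisfy ζ^(2^(2t)) = ζ and ζ^(2^t) = ζ + 1, let b, c ∈ F_{2^t}, and set a = b + c·ζ. Then for every x ∈ F_{2^t} (viewed inside F_{2^n}): (x + a)^((2^n−1)/(2^t−1)) = (x² + c·x + b² + b·c + c²·(ζ + ζ²))^(2^(s−1)). Moreover ζ + ζ² lies in F_{2^t}. -/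
/-- If `y ^ (q ^ 2) = y`, then `y` to the power `1 + q + ⋯ + q ^ (2m - 1)` is
`(y * y ^ q) ^ m`. -/
theorem pow_geomSum_two_mul {M : Type*} [CommMonoid M] {q : ℕ} {y : M}
    (hy : y ^ (q ^ 2) = y) (m : ℕ) :
    y ^ (∑ i ∈ Finset.range (2 * m), q ^ i) = (y * y ^ q) ^ m := by
  have hfix (k : ℕ) : y ^ (q ^ (2 * k)) = y := by
    induction k with
    | zero => simp
    | succ k ih => rw [Nat.mul_succ, pow_add, pow_mul, ih, hy]
  induction m with
  | zero => simp
  | succ m ih =>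
    rw [Nat.mul_succ, Finset.sum_range_succ, Finset.sum_range_succ, pow_add, pow_add, ih,
      pow_succ q (2 * m), pow_mul y, hfix, pow_succ, mul_assoc]


/-- Identity (12)–(13): for `n = 2^s·t`, `ζ ∈ F_{2^{2t}}` with `ζ^(2^t) = ζ + 1`,
`b, c ∈ F_{2^t}` and `a = b + c·ζ`, we have, for every `x ∈ F_{2^t}`,
`(x+a)^((2^n-1)/(2^t-1)) = (x² + c·x + b² + b·c + c²·(ζ+ζ²))^(2^(s-1))`,
and moreover `ζ + ζ² ∈ F_{2^t}`. -/
theorem binomial_norm_expansion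
    (s t : ℕ) (hs : 0 < s) (ht : 0 < t) (n : ℕ) (hn : n = 2 ^ s * t)
    (ζ b c : GaloisField 2 n)
    (hζsub : ζ ^ (2 ^ (2 * t)) = ζ) (hζ : ζ ^ (2 ^ t) = ζ + 1)
    (hb : b ^ (2 ^ t) = b) (hc : c ^ (2 ^ t) = c)
    (a : GaloisField 2 n) (hadef : a = b + c * ζ) :
    (∀ x : GaloisField 2 n, x ^ (2 ^ t) = x →
        (x + a) ^ ((2 ^ n - 1) / (2 ^ t - 1)) =
          (x ^ 2 + c * x + b ^ 2 + b * c + c ^ 2 * (ζ + ζ ^ 2)) ^ (2 ^ (s - 1))) ∧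
      (ζ + ζ ^ 2) ^ (2 ^ t) = ζ + ζ ^ 2 := by
  have h2 : (2 : GaloisField 2 n) = 0 := CharTwo.two_eq_zero
  subst hadef
  refine ⟨fun x hx => ?_, ?_⟩
  · have hy : (x + (b + c * ζ)) ^ (2 ^ t) = x + (b + c * ζ) + c := by
      rw [add_pow_char_pow, add_pow_char_pow, mul_pow, hx, hb, hc, hζ]
      ring
    have hy2 : (x + (b + c * ζ)) ^ ((2 ^ t) ^ 2) = x + (b + c * ζ) := by
      rw [pow_two (2 ^ t), pow_mul, hy, add_pow_char_pow, hy, hc]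
      linear_combination c * h2
    have hexp : (2 ^ n - 1) / (2 ^ t - 1) =
        ∑ i ∈ Finset.range (2 * 2 ^ (s - 1)), (2 ^ t) ^ i := by
      rw [Nat.geomSum_eq (Nat.le_self_pow ht.ne' 2), mul_pow_sub_one hs.ne', ← pow_mul, hn,
        mul_comm t]
    rw [hexp, pow_geomSum_two_mul hy2, hy]
    congr 1
    linear_combination (x * b + x * c * ζ + b * c * ζ) * h2
  · rw [add_pow_char_pow, ← pow_mul, mul_comm 2, pow_mul, hζ]
    linear_combination (ζ + 1) * h2
end

section
/- Let s and t be integers with 3 ≤ s < t. If u, v, w are nonnegative integers and ℓ is a nonnegative integer such that u + v + w = 2^t − 3 and (2^s+1)·u + (2^(s−1)+1)·v + w = ℓ·(2^t − 1), then ℓ = 3 or ℓ = 2^(s−1) + 3. -/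
/-- The possible values of `ℓ` for the exponent equations of Case 1:
if `u + v + w = 2^t - 3` and `(2^s+1)u + (2^(s-1)+1)v + w = ℓ(2^t - 1)`
with `3 ≤ s < t`, then `ℓ = 3` or `ℓ = 2^(s-1) + 3`. -/
theorem ell_values_case_one
    (s t : ℕ) (hs : 3 ≤ s) (hst : s < t) (u v w ℓ : ℕ)
    (h1 : u + v + w = 2 ^ t - 3)
    (h2 : (2 ^ s + 1) * u + (2 ^ (s - 1) + 1) * v + w = ℓ * (2 ^ t - 1)) :
    ℓ = 3 ∨ ℓ = 2 ^ (s - 1) + 3 := by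
  obtain ⟨a, ha⟩ : ∃ a, a = 2 ^ (s - 1) := ⟨_, rfl⟩
  obtain ⟨m, hm⟩ : ∃ m, m = 2 ^ (t - (s - 1)) := ⟨_, rfl⟩
  have h2s : 2 ^ s = 2 * a := by
    rw [ha, ← pow_succ', Nat.sub_add_cancel (by lia)]
  have h2t : 2 ^ t = a * m := by
    rw [ha, hm, ← pow_add, Nat.add_sub_cancel' (by lia)]
  have ha4 : 4 ≤ a := by
    rw [ha]
    exact Nat.pow_le_pow_right two_pos (show 2 ≤ s - 1 by lia)
  have hm1 : 1 ≤ m := hm ▸ Nat.one_le_two_pow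
  rw [← ha, h2s, h2t] at h2
  rw [h2t] at h1
  rw [← ha]
  have hN : 4 ≤ a * m := by nlinarith
  zify [show 3 ≤ a * m by lia, show 1 ≤ a * m by lia] at *
  have hk : (ℓ : ℤ) = 3 + a * (ℓ * m - 2 * u - v - m) := by linear_combination h2 - h1
  have hℓ : (ℓ : ℤ) < 2 * a + 1 := by
    by_contra! h
    nlinarith [mul_le_mul_of_nonneg_right h (show (0 : ℤ) ≤ a * m - 1 by lia),
      mul_nonneg (show (0 : ℤ) ≤ a by lia) (show (0 : ℤ) ≤ v by lia),
      mul_nonneg (show (0 : ℤ) ≤ a by lia) (show (0 : ℤ) ≤ w by lia)]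
  generalize (ℓ * m - 2 * u - v - m : ℤ) = k at hk
  have hk0 : 0 ≤ k := by
    by_contra! h
    nlinarith
  have hk2 : k < 2 := by
    by_contra! h
    nlinarith
  interval_cases k <;> lia
end

section
/- Let s and t be integers with 3 ≤ s < t. If u, v, w are nonnegative integers satisfying u + v + w = 2^t − 3 and (2^s+1)·u + (2^(s−1)+1)·v + w = (2^(s−1)+3)·(2^t − 1), then the multinomial coefficient (2^t−3)! / (u!·v!·w!) is even. -/
theorem Nat.two_dvd_choose_of_even_of_odd {n k : ℕ} (hn : n % 2 = 0) (hk : k % 2 = 1) :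
    2 ∣ n.choose k := by
  have h := Choose.choose_modEq_choose_mod_mul_choose_div_nat (n := n) (k := k) (p := 2)
  rw [hn, hk, Nat.choose_zero_succ, zero_mul] at h
  exact (Nat.modEq_zero_iff_dvd).1 h

theorem Nat.two_dvd_choose_of_mod_four {n k : ℕ} (hn : n % 4 = 1) (hk : k % 4 = 3) :
    2 ∣ n.choose k := by
  have h := Choose.choose_modEq_choose_mod_mul_choose_div_nat (n := n) (k := k) (p := 2)
  have hd : 2 ∣ (n / 2).choose (k / 2) :=
    Nat.two_dvd_choose_of_even_of_odd (by omega) (by omega)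
  exact (Nat.modEq_zero_iff_dvd).1 (h.trans ((Nat.modEq_zero_iff_dvd).2 (hd.mul_left _)))

theorem Nat.factorial_div_eq_choose_mul_choose (u v w : ℕ) :
    (u + v + w).factorial / (u.factorial * v.factorial * w.factorial) =
      (u + v + w).choose v * (u + w).choose u := by
  apply Nat.div_eq_of_eq_mul_left (by positivity)
  have hv := Nat.add_choose_mul_factorial_mul_factorial v (u + w)
  have hu := Nat.add_choose_mul_factorial_mul_factorial u w
  rw [show u + v + w = v + (u + w) by ring, ← hv, ← hu, Nat.choose_symm_add (a := v)]
  rw [Nat.choose_symm_add (a := u)]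
  ring

/-- Subcase 1.2: for `3 ≤ s < t`, if `u + v + w = 2^t - 3` and
`(2^s+1)u + (2^(s-1)+1)v + w = (2^(s-1)+3)(2^t-1)`, then the multinomial
coefficient `(2^t-3)! / (u!·v!·w!)` is even. -/
theorem multinomial_even_case_one_ell_large
    (s t : ℕ) (hs : 3 ≤ s) (hst : s < t) (u v w : ℕ)
    (h1 : u + v + w = 2 ^ t - 3)
    (h2 : (2 ^ s + 1) * u + (2 ^ (s - 1) + 1) * v + w =
      (2 ^ (s - 1) + 3) * (2 ^ t - 1)) :
    2 ∣ (2 ^ t - 3).factorial / (u.factorial * v.factorial * w.factorial) := by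
  obtain ⟨r, rfl⟩ : ∃ r, s = r + 1 := ⟨s - 1, by omega⟩
  obtain ⟨d, rfl⟩ : ∃ d, t = r + 1 + d + 1 := ⟨t - (r + 2), by omega⟩
  have hpow : 2 ^ (r + 1 + d + 1) = 4 * 2 ^ (r + d) := by ring
  have hr : 2 ≤ 2 ^ (r + d) := by
    calc 2 = 2 ^ 1 := rfl
      _ ≤ 2 ^ (r + d) := Nat.pow_le_pow_right (by norm_num) (by omega)
  have hN : (u + v + w) + 3 = 4 * (2 ^ r * 2 ^ d) := by rw [← pow_add]; omega
  have hM : 2 ^ (r + 1 + d + 1) - 1 = u + v + w + 2 := by omega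
  rw [hM, Nat.add_sub_cancel, pow_succ] at h2
  have hdiff : u = w + 8 * 2 ^ d + 2 := by
    apply Nat.eq_of_mul_eq_mul_left (show 0 < 2 ^ r by positivity)
    linarith
  rw [← h1, Nat.factorial_div_eq_choose_mul_choose]
  have hv : v % 4 = 3 ∨ v % 4 = 1 := by omega
  rcases hv with hv | hv
  · exact (Nat.two_dvd_choose_of_mod_four (by omega) hv).mul_right _
  · exact (Nat.two_dvd_choose_of_even_of_odd (by omega) (by omega)).mul_left _
end

section
/- Let t be an odd positive integer, s ∈ {1, 2}, and n = 2^s·t. If a ∈ ω·F_{2^t}^* ∪ ω²·F_{2^t}^*, where ω is an element of F_{2^n} satisfying ω² + ω + 1 = 0, then x^((2^n−1)/(2^t−1)+1) + a·x is a permutation polynomial of F_{2^n}. -/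
section CharTwo

variable {K : Type*} [Field K] {t : ℕ} {ω : K}

/-- For odd `t`, raising to the power `2 ^ t` squares a root of `x ^ 2 + x + 1`. -/
theorem omega_pow_two_pow (htodd : Odd t) (hω : ω ^ 2 + ω + 1 = 0) : ω ^ 2 ^ t = ω ^ 2 := by
  have h4 : ω ^ 4 = ω := by linear_combination (ω ^ 2 - ω) * hω
  obtain ⟨m, rfl⟩ := htodd
  induction m with
  | zero => simp
  | succ m ih =>
    rw [show 2 ^ (2 * (m + 1) + 1) = 2 ^ (2 * m + 1) * 4 by ring, pow_mul, ih, ← pow_mul,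
      mul_comm, pow_mul, h4]

variable [CharP K 2]

/-- `X ^ 2 + X * Y + Y ^ 2` is anisotropic over the field with `2 ^ t` elements, `t` odd. -/
theorem eq_zero_of_sq_add_mul_add_sq (htodd : Odd t) (hω : ω ^ 2 + ω + 1 = 0) {X Y : K}
    (hX : X ^ 2 ^ t = X) (hY : Y ^ 2 ^ t = Y) (h : X ^ 2 + X * Y + Y ^ 2 = 0) :
    X = 0 ∧ Y = 0 := by
  have h2 : (2 : K) = 0 := CharTwo.two_eq_zero
  have hq := omega_pow_two_pow htodd hω
  have hprod : (X - ω * Y) * (X - ω ^ 2 * Y) = 0 := by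
    linear_combination h + (-X * Y + (ω - 1) * Y ^ 2) * hω
  have key : X = ω * Y ∧ X = ω ^ 2 * Y := by
    rcases mul_eq_zero.1 hprod with h0 | h0
    · have h1 : X = ω * Y := sub_eq_zero.1 h0
      refine ⟨h1, ?_⟩
      have := congrArg (· ^ 2 ^ t) h1
      simpa only [mul_pow, hX, hY, hq] using this
    · have h1 : X = ω ^ 2 * Y := sub_eq_zero.1 h0
      refine ⟨?_, h1⟩
      have := congrArg (· ^ 2 ^ t) h1
      simp only [mul_pow, hX, hY, ← pow_mul, mul_comm 2] at this
      rw [pow_mul, hq] at this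
      linear_combination this + (ω ^ 2 - ω) * Y * hω
  have hY0 : Y = 0 := by
    linear_combination Y * hω - key.1 + key.2 - ω * Y * h2
  exact ⟨by rw [key.1, hY0, mul_zero], hY0⟩

theorem add_omega_mul_pow_two_pow (htodd : Odd t) (hω : ω ^ 2 + ω + 1 = 0) {u b : K}
    (hu : u ^ 2 ^ t = u) (hb : b ^ 2 ^ t = b) :
    (u + ω * b) ^ 2 ^ t = u + ω ^ 2 * b := by
  rw [add_pow_char_pow, mul_pow, hu, hb, omega_pow_two_pow htodd hω]

theorem add_omega_mul_ne_zero (htodd : Odd t) (hω : ω ^ 2 + ω + 1 = 0) {u b : K}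
    (hu : u ^ 2 ^ t = u) (hb : b ^ 2 ^ t = b) (hb0 : b ≠ 0) : u + ω * b ≠ 0 := by
  intro h
  have h2 : (2 : K) = 0 := CharTwo.two_eq_zero
  refine hb0 (eq_zero_of_sq_add_mul_add_sq htodd hω hu hb ?_).2
  linear_combination (u + ω ^ 2 * b) * h + (u * b + (1 - ω) * b ^ 2) * hω
    - (ω ^ 2 + ω) * u * b * h2

/-- `u ^ 3 + b * u ^ 2 + b ^ 2 * u` is injective on the field with `2 ^ t` elements, `t` odd. -/
theorem cubic_injective (htodd : Odd t) (hω : ω ^ 2 + ω + 1 = 0) {u v b : K}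
    (hu : u ^ 2 ^ t = u) (hv : v ^ 2 ^ t = v) (hb : b ^ 2 ^ t = b)
    (h : u * (u ^ 2 + u * b + b ^ 2) = v * (v ^ 2 + v * b + b ^ 2)) : u = v := by
  have h2 : (2 : K) = 0 := CharTwo.two_eq_zero
  by_contra hne
  have hfac : (u - v) * ((u + b) ^ 2 + (u + b) * (v + b) + (v + b) ^ 2) = 0 := by
    linear_combination h + (u - v) * (b ^ 2 + b * u + b * v) * h2
  obtain ⟨h₁, h₂⟩ := eq_zero_of_sq_add_mul_add_sq htodd hω
    (by rw [add_pow_char_pow, hu, hb]) (by rw [add_pow_char_pow, hv, hb])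
    ((mul_eq_zero.1 hfac).resolve_left (sub_ne_zero.2 hne))
  exact hne (by linear_combination h₁ - h₂)

/-- The Dickson polynomial `u ^ 5 + b ^ 2 * u ^ 3 + b ^ 4 * u` is injective on the field with
`2 ^ t` elements, `t` odd. -/
theorem quintic_injective (htodd : Odd t) (hω : ω ^ 2 + ω + 1 = 0) {u v b : K}
    (hu : u ^ 2 ^ t = u) (hv : v ^ 2 ^ t = v) (hb : b ^ 2 ^ t = b)
    (h : u * (u ^ 2 + u * b + b ^ 2) ^ 2 = v * (v ^ 2 + v * b + b ^ 2) ^ 2) : u = v := by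
  have h2 : (2 : K) = 0 := CharTwo.two_eq_zero
  by_contra hne
  have hfac : (u - v) * ((u * v + b ^ 2) ^ 2 + (u * v + b ^ 2) * (u ^ 2 + v ^ 2 + b ^ 2)
      + (u ^ 2 + v ^ 2 + b ^ 2) ^ 2) = 0 := by
    linear_combination h + (u ^ 3 * v ^ 2 - u ^ 2 * v ^ 3 + u * b ^ 4 - v * b ^ 4
      - u ^ 4 * b - u ^ 2 * b ^ 3 + v ^ 4 * b + v ^ 2 * b ^ 3) * h2
  obtain ⟨h₁, h₂⟩ := eq_zero_of_sq_add_mul_add_sq htodd hω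
    (by simp only [add_pow_char_pow, mul_pow, hu, hv, ← pow_mul, mul_comm 2]
        simp only [pow_mul, hb])
    (by simp only [add_pow_char_pow, ← pow_mul, mul_comm 2]
        simp only [pow_mul, hu, hv, hb])
    ((mul_eq_zero.1 hfac).resolve_left (sub_ne_zero.2 hne))
  obtain ⟨hu0, hv0⟩ := eq_zero_of_sq_add_mul_add_sq htodd hω hu hv
    (by linear_combination h₁ + h₂ - b ^ 2 * h2)
  exact hne (hu0.trans hv0.symm)

/-- If `d` is the exponent of the norm to the field with `q = 2 ^ t` elements and the norm of
`u + ω * b`, multiplied by `u`, is injective in `u`, then so is `x ^ (d + 1) + ω * b * x`. -/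
theorem binomial_injective_of_norm {d : ℕ} (htodd : Odd t) (hω : ω ^ 2 + ω + 1 = 0) {b : K}
    (hb : b ^ 2 ^ t = b) (hb0 : b ≠ 0) (hd : ∀ x : K, (x ^ d) ^ 2 ^ t = x ^ d)
    (hinj : ∀ u v : K, u ^ 2 ^ t = u → v ^ 2 ^ t = v →
      u * (u + ω * b) ^ d = v * (v + ω * b) ^ d → u = v) :
    Function.Injective (fun x : K => x ^ (d + 1) + ω * b * x) := by
  intro x y hxy
  have hf : x * (x ^ d + ω * b) = y * (y ^ d + ω * b) := by
    simp only [pow_succ] at hxy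
    linear_combination hxy
  have hu : x ^ d = y ^ d := hinj _ _ (hd x) (hd y) (by
    simpa only [mul_pow] using congrArg (· ^ d) hf)
  rw [hu] at hf
  exact mul_right_cancel₀ (add_omega_mul_ne_zero htodd hω (hd y) hb hb0) hf

theorem binomial_injective_of_card_sq (htodd : Odd t) (hω : ω ^ 2 + ω + 1 = 0) {b : K}
    (hb : b ^ 2 ^ t = b) (hb0 : b ≠ 0) (hK : ∀ x : K, (x ^ 2 ^ t) ^ 2 ^ t = x) :
    Function.Injective (fun x : K => x ^ (2 ^ t + 1 + 1) + ω * b * x) := by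
  have h2 : (2 : K) = 0 := CharTwo.two_eq_zero
  refine binomial_injective_of_norm htodd hω hb hb0 (fun x => ?_) fun u v hu hv h => ?_
  · rw [pow_succ, mul_pow, hK, mul_comm]
  · have hN : ∀ w : K, w ^ 2 ^ t = w → (w + ω * b) ^ (2 ^ t + 1) = w ^ 2 + w * b + b ^ 2 := by
      intro w hw
      rw [pow_succ, add_omega_mul_pow_two_pow htodd hω hw hb]
      linear_combination (w * b + (ω - 1) * b ^ 2) * hω - w * b * h2
    rw [hN u hu, hN v hv] at h
    exact cubic_injective htodd hω hu hv hb h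

theorem binomial_injective_of_card_pow_four (htodd : Odd t) (hω : ω ^ 2 + ω + 1 = 0) {b : K}
    (hb : b ^ 2 ^ t = b) (hb0 : b ≠ 0)
    (hK : ∀ x : K, (((x ^ 2 ^ t) ^ 2 ^ t) ^ 2 ^ t) ^ 2 ^ t = x) :
    Function.Injective
      (fun x : K => x ^ ((2 ^ t) ^ 3 + (2 ^ t) ^ 2 + 2 ^ t + 1 + 1) + ω * b * x) := by
  have h2 : (2 : K) = 0 := CharTwo.two_eq_zero
  have hexp : ∀ x : K, x ^ ((2 ^ t) ^ 3 + (2 ^ t) ^ 2 + 2 ^ t + 1) =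
      ((x ^ 2 ^ t) ^ 2 ^ t) ^ 2 ^ t * (x ^ 2 ^ t) ^ 2 ^ t * x ^ 2 ^ t * x := by
    intro x
    simp only [← pow_mul, ← pow_add, ← pow_succ]
    ring_nf
  refine binomial_injective_of_norm htodd hω hb hb0 (fun x => ?_) fun u v hu hv h => ?_
  · rw [hexp, mul_pow, mul_pow, mul_pow, hK]
    ring
  · have hN : ∀ w : K, w ^ 2 ^ t = w → (w + ω * b) ^ ((2 ^ t) ^ 3 + (2 ^ t) ^ 2 + 2 ^ t + 1) =
        (w ^ 2 + w * b + b ^ 2) ^ 2 := by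
      intro w hw
      have h4 : ω ^ 4 = ω := by linear_combination (ω ^ 2 - ω) * hω
      have hconj : (w + ω ^ 2 * b) ^ 2 ^ t = w + ω * b := by
        rw [add_omega_mul_pow_two_pow htodd
          (by linear_combination (ω ^ 2 - ω + 1) * hω) hw hb, ← pow_mul, h4]
      rw [hexp, add_omega_mul_pow_two_pow htodd hω hw hb, hconj,
        add_omega_mul_pow_two_pow htodd hω hw hb]
      have hq : (w + ω ^ 2 * b) * (w + ω * b) = w ^ 2 + w * b + b ^ 2 := by
        linear_combination (w * b + (ω - 1) * b ^ 2) * hω - w * b * h2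
      rw [← hq]
      ring
    rw [hN u hu, hN v hv] at h
    exact quintic_injective htodd hω hu hv hb h

end CharTwo

/-- Sufficiency direction of Theorem 1.1: for odd `t`, `s ∈ {1,2}`,
`n = 2^s·t`, and `a ∈ ω·F_{2^t}^* ∪ ω²·F_{2^t}^*` with `ω² + ω + 1 = 0`,
the binomial `x^((2^n-1)/(2^t-1)+1) + a·x` is a permutation polynomial
of `F_{2^n}`. -/
theorem permutation_binomial_sufficiency
    (s t : ℕ) (ht : 0 < t) (htodd : Odd t) (hs : s = 1 ∨ s = 2)
    (n : ℕ) (hn : n = 2 ^ s * t)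
    (ω a : GaloisField 2 n) (hω : ω ^ 2 + ω + 1 = 0)
    (ha : ∃ b : GaloisField 2 n, b ^ (2 ^ t) = b ∧ b ≠ 0 ∧
      (a = ω * b ∨ a = ω ^ 2 * b)) :
    Function.Bijective
      (fun x : GaloisField 2 n =>
        x ^ ((2 ^ n - 1) / (2 ^ t - 1) + 1) + a * x) := by
  have hn0 : n ≠ 0 := by subst hn; positivity
  have hcard : ∀ x : GaloisField 2 n, x ^ 2 ^ n = x := fun x => by
    have := Fintype.ofFinite (GaloisField 2 n)
    rw [← GaloisField.card 2 n hn0, Nat.card_eq_fintype_card, FiniteField.pow_card]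
  have hq : 0 < 2 ^ t - 1 := Nat.sub_pos_of_lt (Nat.one_lt_two_pow ht.ne')
  obtain ⟨ω', b, hω', hb, hb0, rfl⟩ : ∃ ω' b : GaloisField 2 n, ω' ^ 2 + ω' + 1 = 0 ∧
      b ^ 2 ^ t = b ∧ b ≠ 0 ∧ a = ω' * b := by
    obtain ⟨b, hb, hb0, h | h⟩ := ha
    · exact ⟨ω, b, hω, hb, hb0, h⟩
    · exact ⟨ω ^ 2, b, by linear_combination (ω ^ 2 - ω + 1) * hω, hb, hb0, h⟩
  apply Finite.injective_iff_bijective.1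
  obtain ⟨r, hr⟩ : ∃ r, 2 ^ t = r + 1 := ⟨2 ^ t - 1, by omega⟩
  rcases hs with rfl | rfl
  · have hd : (2 ^ n - 1) / (2 ^ t - 1) = 2 ^ t + 1 := by
      refine Nat.div_eq_of_eq_mul_left hq ?_
      rw [hn, pow_one, mul_comm 2 t, pow_mul, hr, Nat.add_sub_cancel]
      exact Nat.sub_eq_of_eq_add (by ring)
    rw [hd]
    refine binomial_injective_of_card_sq htodd hω' hb hb0 fun x => ?_
    rw [← pow_mul, ← pow_add]
    convert hcard x using 3
    omega
  · have hd : (2 ^ n - 1) / (2 ^ t - 1) = (2 ^ t) ^ 3 + (2 ^ t) ^ 2 + 2 ^ t + 1 := by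
      refine Nat.div_eq_of_eq_mul_left hq ?_
      rw [hn, mul_comm _ t, pow_mul, hr, Nat.add_sub_cancel]
      exact Nat.sub_eq_of_eq_add (by ring)
    rw [hd]
    refine binomial_injective_of_card_pow_four htodd hω' hb hb0 fun x => ?_
    simp only [← pow_mul, ← pow_add]
    convert hcard x using 3
    omega
end
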